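/- arXiv:0802.3039 — 2 statements merged into one kernel-verified Lean document; each statement's English description precedes it below -/
import Mathlib

section
/- Let f^{ap}(τ,r) = ln P^{ap}(τ,r) and define the residual h(τ,r) = −∂_τ f^{ap} + (1/2)σ²r^{2γ}[(∂_r f^{ap})² + ∂²_r f^{ap}] + (α+βr)∂_r f^{ap} − r. Then for every compact interval [r₁,r₂] ⊂ (0,∞), h(τ,r) = k₄(r)τ⁴ + k₅(r)τ⁵ + o(τ⁵) as τ → 0⁺, uniformly with respect to r ∈ [r₁,r₂]. -/
open Set MeasureTheory Real Filter Topology Asymptotics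

noncomputable section

/-- Partial derivative of `P = P(τ,r)` with respect to `τ`. -/
def pTau (P : ℝ → ℝ → ℝ) (τ r : ℝ) : ℝ := deriv (fun t => P t r) τ

/-- Partial derivative of `P = P(τ,r)` with respect to `r`. -/
def pR (P : ℝ → ℝ → ℝ) (τ r : ℝ) : ℝ := deriv (fun x => P τ x) r

/-- Second partial derivative of `P = P(τ,r)` with respect to `r`. -/
def pRR (P : ℝ → ℝ → ℝ) (τ r : ℝ) : ℝ := deriv (fun x => pR P τ x) r

/-- A complete solution of the bond pricing PDE
`-∂_τ P + (1/2) σ² r^{2γ} ∂²_r P + (α + β r) ∂_r P - r P = 0`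
on `r > 0`, `τ ∈ (0,T)`, with initial condition `P(0,r) = 1`, continuous partial
derivatives on `[0,∞) × (0,T)` and the growth conditions
`|P(τ,r)| ≤ M e^{-m r^δ}`, `|∂_r P(τ,r)| ≤ M`. -/
structure IsCompleteSolution (σ α β γ T : ℝ) (P : ℝ → ℝ → ℝ) : Prop where
  diff_tau : ∀ τ ∈ Ioo (0:ℝ) T, ∀ r ∈ Ici (0:ℝ), DifferentiableAt ℝ (fun t => P t r) τ
  diff_r : ∀ τ ∈ Ioo (0:ℝ) T, ∀ r ∈ Ici (0:ℝ), DifferentiableAt ℝ (fun x => P τ x) r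
  diff_rr : ∀ τ ∈ Ioo (0:ℝ) T, ∀ r ∈ Ici (0:ℝ), DifferentiableAt ℝ (fun x => pR P τ x) r
  cont_tau : ContinuousOn (fun p : ℝ × ℝ => pTau P p.1 p.2) (Ioo 0 T ×ˢ Ici 0)
  cont_r : ContinuousOn (fun p : ℝ × ℝ => pR P p.1 p.2) (Ioo 0 T ×ˢ Ici 0)
  cont_rr : ContinuousOn (fun p : ℝ × ℝ => pRR P p.1 p.2) (Ioo 0 T ×ˢ Ici 0)
  pde : ∀ τ ∈ Ioo (0:ℝ) T, ∀ r : ℝ, 0 < r →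
      -pTau P τ r + (1/2) * σ^2 * r ^ (2*γ) * pRR P τ r
        + (α + β * r) * pR P τ r - r * P τ r = 0
  init : ∀ r : ℝ, 0 ≤ r → P 0 r = 1
  growth : ∃ M m δ : ℝ, 0 < M ∧ 0 < m ∧ 0 < δ ∧
      ∀ τ ∈ Ioo (0:ℝ) T, ∀ r : ℝ, 0 < r →
        |P τ r| ≤ M * Real.exp (-m * r ^ δ) ∧ |pR P τ r| ≤ M

/-- `B(τ) = (e^{βτ} - 1)/β`. -/
def Bfun (β τ : ℝ) : ℝ := (Real.exp (β * τ) - 1) / β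

/-- `q(r) = γ(2γ-1)σ² r^{2(2γ-1)} + 2γ r^{2γ-1}(α + βr)`. -/
def qfun (σ α β γ r : ℝ) : ℝ :=
  γ * (2*γ - 1) * σ^2 * r ^ (2*(2*γ - 1)) + 2*γ * r ^ (2*γ - 1) * (α + β * r)

/-- Logarithm of the Choi–Wirjanto approximation of the bond price. -/
def lnPap (σ α β γ τ r : ℝ) : ℝ :=
  -r * Bfun β τ + (α/β) * (τ - Bfun β τ)
    + (r ^ (2*γ) + qfun σ α β γ r * τ) * (σ^2/(4*β)) *
        ((Bfun β τ)^2 + (2/β) * (τ - Bfun β τ))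
    - qfun σ α β γ r * (σ^2/(8*β^2)) *
        ((Bfun β τ)^2 * (2*β*τ - 1) - 2 * Bfun β τ * (2*τ - 3/β) + 2*τ^2 - 6*τ/β)

/-- The coefficient `k₄(r)`. -/
def k4 (σ α β γ r : ℝ) : ℝ :=
  (1/24) * γ * r ^ (2*(γ-2)) * σ^2 *
    (2*α^2*(2*γ-1)*r^2 + 4*β^2*γ*r^4 - 8 * r ^ (3+2*γ) * σ^2
      + 2*β*(1 - 5*γ + 6*γ^2) * r ^ (2*(1+γ)) * σ^2
      + σ^4 * r ^ (4*γ) * (-3 + 16*γ - 28*γ^2 + 16*γ^3)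
      + 2*α*r*(β*(4*γ-1)*r^2 + (2 - 7*γ + 6*γ^2) * r ^ (2*γ) * σ^2))

/-- The coefficient `k₅(r)`. -/
def k5 (σ α β γ r : ℝ) : ℝ :=
  (γ*σ^2/120) * r ^ (2*(γ-2)) *
    (6*α^2*β*(2*γ-1)*r^2 + 12*β^3*γ*r^4 - 10*(1-2*γ)^2 * r ^ (1+4*γ) * σ^4
      + 6*β^2*σ^2*(1 - 5*γ + 6*γ^2) * r ^ (2*(1+γ))
      + β * r ^ (2*γ) * σ^2 * (-10*(5+2*γ)*r^3 + 3*(1-2*γ)^2*(4*γ-3) * r ^ (2*γ) * σ^2)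
      + 2*α*r*(3*β^2*(4*γ-1)*r^2 + 3*β*(2-7*γ+6*γ^2) * r ^ (2*γ) * σ^2
          - 5*(2*γ-1) * r ^ (1+2*γ) * σ^2))

/-- The residual obtained by substituting `f^{ap} = ln P^{ap}` into the PDE for the
logarithm of the bond price:
`h(τ,r) = -∂_τ f^{ap} + (1/2)σ² r^{2γ}[(∂_r f^{ap})² + ∂²_r f^{ap}] + (α+βr)∂_r f^{ap} - r`. -/
def residualFn (σ α β γ τ r : ℝ) : ℝ :=
  -pTau (lnPap σ α β γ) τ r
    + (1/2) * σ^2 * r ^ (2*γ) *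
        ((pR (lnPap σ α β γ) τ r)^2 + pRR (lnPap σ α β γ) τ r)
    + (α + β*r) * pR (lnPap σ α β γ) τ r - r

/-- A function vanishing at `0` whose derivative is `O(x ^ n)` is itself `O(x ^ (n + 1))`. -/
lemma isBigO_pow_succ_of_hasDerivAt {f f' : ℝ → ℝ} {n : ℕ} (h0 : f 0 = 0)
    (hf : ∀ x, HasDerivAt f (f' x) x) (h : f' =O[𝓝 0] fun x => x ^ n) :
    f =O[𝓝 0] fun x => x ^ (n + 1) := by
  obtain ⟨C, hC⟩ := h.bound
  obtain ⟨ε, hε, hball⟩ := Metric.eventually_nhds_iff_ball.1 hC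
  have hC0 : ∀ x ∈ Metric.ball (0 : ℝ) ε, ‖f' x‖ ≤ |C| * ‖x‖ ^ n := fun x hx =>
    (hball x hx).trans <| by
      rw [norm_pow]
      exact mul_le_mul_of_nonneg_right (le_abs_self C) (by positivity)
  refine IsBigO.of_bound |C| ?_
  filter_upwards [Metric.ball_mem_nhds (0 : ℝ) hε] with x hx
  have key := (convex_closedBall (0 : ℝ) ‖x‖).norm_image_sub_le_of_norm_hasDerivWithin_le
    (f := f) (f' := f') (C := |C| * ‖x‖ ^ n) (x := 0) (y := x)
    (fun y _ => (hf y).hasDerivWithinAt)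
    (fun y hy => by
      rw [mem_closedBall_zero_iff] at hy
      refine (hC0 y ?_).trans ?_
      · rw [mem_ball_zero_iff] at hx ⊢
        exact hy.trans_lt hx
      · gcongr)
    (by simp) (by simp)
  rw [h0, sub_zero, sub_zero] at key
  rw [norm_pow, pow_succ, ← mul_assoc]
  exact key

/-- The factor of `r ^ (2γ)` in the approximation. -/
def Gfun (σ β τ : ℝ) : ℝ := σ^2/(4*β) * ((Bfun β τ)^2 + (2/β) * (τ - Bfun β τ))

/-- The factor of `q(r)` in the approximation. -/
def Hfun (σ β τ : ℝ) : ℝ :=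
  τ * Gfun σ β τ - (σ^2/(8*β^2)) *
    ((Bfun β τ)^2 * (2*β*τ - 1) - 2 * Bfun β τ * (2*τ - 3/β) + 2*τ^2 - 6*τ/β)

lemma hasDerivAt_Bfun {β : ℝ} (hβ : β ≠ 0) (τ : ℝ) :
    HasDerivAt (Bfun β) (1 + β * Bfun β τ) τ := by
  have h := ((((hasDerivAt_id τ).const_mul β).exp).sub_const 1).div_const β
  refine h.congr_deriv ?_
  simp only [Bfun, id]
  field_simp
  ring

lemma hasDerivAt_Gfun (σ : ℝ) {β : ℝ} (hβ : β ≠ 0) (τ : ℝ) :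
    HasDerivAt (Gfun σ β) (σ^2/2 * (Bfun β τ)^2) τ := by
  have hB := hasDerivAt_Bfun hβ τ
  have h := ((hB.pow 2).add (((hasDerivAt_id τ).sub hB).const_mul (2/β))).const_mul (σ^2/(4*β))
  refine h.congr_deriv ?_
  field_simp
  push_cast
  ring

lemma hasDerivAt_Hfun (σ : ℝ) {β : ℝ} (hβ : β ≠ 0) (τ : ℝ) :
    HasDerivAt (Hfun σ β) (Gfun σ β τ) τ := by
  have hB := hasDerivAt_Bfun hβ τ
  have hi := hasDerivAt_id τ
  have h := (hi.mul (hasDerivAt_Gfun σ hβ τ)).sub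
    ((((((hB.pow 2).mul ((hi.const_mul (2*β)).sub_const 1)).sub
      ((hB.const_mul 2).mul ((hi.const_mul 2).sub_const (3/β)))).add
      ((hi.pow 2).const_mul 2)).sub ((hi.const_mul 6).div_const β)).const_mul (σ^2/(8*β^2)))
  refine h.congr_deriv ?_
  simp only [id, Pi.pow_apply]
  field_simp
  push_cast
  ring

lemma Bfun_zero (β : ℝ) : Bfun β 0 = 0 := by simp [Bfun]

lemma Gfun_zero (σ β : ℝ) : Gfun σ β 0 = 0 := by simp [Gfun, Bfun_zero]

lemma Hfun_zero (σ β : ℝ) : Hfun σ β 0 = 0 := by simp [Hfun, Bfun_zero]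

lemma isBigO_pow_of_le {m n : ℕ} (h : n ≤ m) :
    (fun x : ℝ => x ^ m) =O[𝓝 0] fun x => x ^ n :=
  IsBigO.of_bound 1 <| Eventually.mono (Metric.closedBall_mem_nhds (0 : ℝ) one_pos) fun x hx => by
    rw [norm_pow, norm_pow, one_mul]
    exact pow_le_pow_of_le_one (norm_nonneg x) (mem_closedBall_zero_iff.1 hx) h

/-- Products of `O(x ^ a)` and `O(x ^ b)` are `O(x ^ c)` near zero whenever `c ≤ a + b`. -/
lemma isBigO_mul_pow {f g : ℝ → ℝ} {a b c : ℕ} (hf : f =O[𝓝 0] fun x => x ^ a)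
    (hg : g =O[𝓝 0] fun x => x ^ b) (h : c ≤ a + b) :
    (fun x => f x * g x) =O[𝓝 0] fun x => x ^ c := by
  refine (hf.mul hg).trans ?_
  simp only [← pow_add]
  exact isBigO_pow_of_le h

lemma Bfun_isBigO {β : ℝ} (hβ : β ≠ 0) : Bfun β =O[𝓝 0] fun τ => τ ^ 1 := by
  refine isBigO_pow_succ_of_hasDerivAt (Bfun_zero β) (hasDerivAt_Bfun hβ) ?_
  simp only [pow_zero]
  have : ContinuousAt (fun τ => 1 + β * Bfun β τ) 0 :=
    ((hasDerivAt_Bfun hβ 0).continuousAt.const_mul β).const_add 1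
  exact this.isBigO_one ℝ

lemma Bfun_sub_isBigO {β : ℝ} (hβ : β ≠ 0) :
    (fun τ => Bfun β τ - τ) =O[𝓝 0] fun τ => τ ^ 2 := by
  refine isBigO_pow_succ_of_hasDerivAt (f' := fun τ => β * Bfun β τ) (by simp [Bfun_zero])
    (fun τ => ((hasDerivAt_Bfun hβ τ).sub (hasDerivAt_id τ)).congr_deriv (by ring)) ?_
  exact (Bfun_isBigO hβ).const_mul_left β

lemma Bfun_sub_sub_isBigO {β : ℝ} (hβ : β ≠ 0) :
    (fun τ => Bfun β τ - τ - β/2 * τ^2) =O[𝓝 0] fun τ => τ ^ 3 := by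
  refine isBigO_pow_succ_of_hasDerivAt (f' := fun τ => β * (Bfun β τ - τ)) (by simp [Bfun_zero])
    (fun τ => (((hasDerivAt_Bfun hβ τ).sub (hasDerivAt_id τ)).sub
      ((hasDerivAt_pow 2 τ).const_mul (β/2))).congr_deriv (by push_cast; ring)) ?_
  exact (Bfun_sub_isBigO hβ).const_mul_left β

lemma Bfun_sq_sub_isBigO {β : ℝ} (hβ : β ≠ 0) :
    (fun τ => (Bfun β τ)^2 - τ^2 - β * τ^3) =O[𝓝 0] fun τ => τ ^ 4 := by
  have h1 : (fun τ : ℝ => τ) =O[𝓝 0] fun τ => τ ^ 1 := by simpa using isBigO_refl _ _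
  have h2 := isBigO_mul_pow (c := 4) h1 (Bfun_sub_sub_isBigO hβ) (by norm_num)
  have h3 := isBigO_mul_pow (c := 4) (Bfun_sub_isBigO hβ) (Bfun_sub_isBigO hβ) (by norm_num)
  refine ((h2.const_mul_left 2).add h3).congr_left fun τ => ?_
  ring

lemma Gfun_sub_isBigO (σ : ℝ) {β : ℝ} (hβ : β ≠ 0) :
    (fun τ => Gfun σ β τ - σ^2 * (τ^3/6 + β * τ^4/8)) =O[𝓝 0] fun τ => τ ^ 5 := by
  refine isBigO_pow_succ_of_hasDerivAt
    (f' := fun τ => σ^2/2 * ((Bfun β τ)^2 - τ^2 - β * τ^3)) (by simp [Gfun_zero])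
    (fun τ => ((hasDerivAt_Gfun σ hβ τ).sub (((hasDerivAt_pow 3 τ).div_const 6).add
      (((hasDerivAt_pow 4 τ).const_mul β).div_const 8) |>.const_mul (σ^2))).congr_deriv
        (by push_cast; ring)) ?_
  exact (Bfun_sq_sub_isBigO hβ).const_mul_left _

lemma Hfun_sub_isBigO (σ : ℝ) {β : ℝ} (hβ : β ≠ 0) :
    (fun τ => Hfun σ β τ - σ^2 * (τ^4/24 + β * τ^5/40)) =O[𝓝 0] fun τ => τ ^ 6 := by
  refine isBigO_pow_succ_of_hasDerivAt
    (f' := fun τ => Gfun σ β τ - σ^2 * (τ^3/6 + β * τ^4/8)) (by simp [Hfun_zero])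
    (fun τ => ((hasDerivAt_Hfun σ hβ τ).sub (((hasDerivAt_pow 4 τ).div_const 24).add
      (((hasDerivAt_pow 5 τ).const_mul β).div_const 40) |>.const_mul (σ^2))).congr_deriv
        (by push_cast; ring)) ?_
  exact Gfun_sub_isBigO σ hβ

lemma Gfun_isBigO (σ : ℝ) {β : ℝ} (hβ : β ≠ 0) : Gfun σ β =O[𝓝 0] fun τ => τ ^ 3 :=
  isBigO_pow_succ_of_hasDerivAt (Gfun_zero σ β) (hasDerivAt_Gfun σ hβ)
    (((isBigO_mul_pow (Bfun_isBigO hβ) (Bfun_isBigO hβ) le_rfl).const_mul_left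
      (σ^2/2)).congr_left fun τ => by ring)

lemma Hfun_isBigO (σ : ℝ) {β : ℝ} (hβ : β ≠ 0) : Hfun σ β =O[𝓝 0] fun τ => τ ^ 4 :=
  isBigO_pow_succ_of_hasDerivAt (Hfun_zero σ β) (hasDerivAt_Hfun σ hβ) (Gfun_isBigO σ hβ)

lemma Bfun_mul_Gfun_sub_isBigO (σ : ℝ) {β : ℝ} (hβ : β ≠ 0) :
    (fun τ => Bfun β τ * Gfun σ β τ - σ^2 * (τ^4/6 + 5 * β * τ^5/24))
      =O[𝓝 0] fun τ => τ ^ 6 := by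
  have h1 := isBigO_mul_pow (c := 6) (Bfun_isBigO hβ) (Gfun_sub_isBigO σ hβ) (by norm_num)
  have h2 := isBigO_mul_pow (c := 6) (Bfun_sub_sub_isBigO hβ)
    (isBigO_refl (fun τ : ℝ => τ ^ 3) (𝓝 0)) (by norm_num)
  have h3 := isBigO_mul_pow (c := 6) (Bfun_sub_isBigO hβ)
    (isBigO_refl (fun τ : ℝ => τ ^ 4) (𝓝 0)) (by norm_num)
  refine ((h1.add (h2.const_mul_left (σ^2/6))).add
    (h3.const_mul_left (σ^2*β/8))).congr_left fun τ => ?_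
  ring

lemma Bfun_mul_Hfun_sub_isBigO (σ : ℝ) {β : ℝ} (hβ : β ≠ 0) :
    (fun τ => Bfun β τ * Hfun σ β τ - σ^2 * (τ^5/24)) =O[𝓝 0] fun τ => τ ^ 6 := by
  have h1 := isBigO_mul_pow (c := 6) (Bfun_isBigO hβ) (Hfun_sub_isBigO σ hβ) (by norm_num)
  have h2 := isBigO_mul_pow (c := 6) (Bfun_sub_isBigO hβ)
    (isBigO_refl (fun τ : ℝ => τ ^ 4) (𝓝 0)) (by norm_num)
  have h3 := isBigO_mul_pow (c := 6) (Bfun_isBigO hβ)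
    (isBigO_refl (fun τ : ℝ => τ ^ 5) (𝓝 0)) (by norm_num)
  refine ((h1.add (h2.const_mul_left (σ^2/24))).add
    (h3.const_mul_left (σ^2*β/40))).congr_left fun τ => ?_
  ring

lemma lnPap_eq (σ α β γ τ r : ℝ) :
    lnPap σ α β γ τ r = -r * Bfun β τ + (α/β) * (τ - Bfun β τ)
      + r ^ (2*γ) * Gfun σ β τ + qfun σ α β γ r * Hfun σ β τ := by
  simp only [lnPap, Hfun, Gfun]
  ring

lemma rpow_two_mul_sub_one {r : ℝ} (hr : 0 < r) (γ : ℝ) :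
    r ^ (2*γ - 1) = r ^ (2*γ) / r := by
  rw [rpow_sub hr, rpow_one]

lemma hasDerivAt_rpow_two_mul (γ : ℝ) {r : ℝ} (hr : 0 < r) :
    HasDerivAt (fun x : ℝ => x ^ (2*γ)) (2*γ * r ^ (2*γ) / r) r := by
  have h := Real.hasDerivAt_rpow_const (x := r) (p := 2*γ) (Or.inl hr.ne')
  rwa [rpow_two_mul_sub_one hr, ← mul_div_assoc] at h

lemma qfun_eq (σ α β γ : ℝ) {r : ℝ} (hr : 0 < r) :
    qfun σ α β γ r = γ * (2*γ - 1) * σ^2 * (r ^ (2*γ) / r)^2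
      + 2*γ * (r ^ (2*γ) / r) * (α + β * r) := by
  have h : r ^ (2*(2*γ - 1)) = (r ^ (2*γ) / r)^2 := by
    rw [← rpow_two_mul_sub_one hr, mul_comm 2 (2*γ - 1), rpow_mul hr.le, rpow_two]
  rw [qfun, h, rpow_two_mul_sub_one hr]

/-- The derivative of `qfun` on `r > 0`. -/
def qfunDeriv (σ α β γ r : ℝ) : ℝ :=
  2 * γ * (2*γ - 1)^2 * σ^2 * (r ^ (2*γ))^2 / r^3
    + 2*γ * (2*γ - 1) * α * r ^ (2*γ) / r^2 + 4*γ^2 * β * r ^ (2*γ) / r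

/-- The second derivative of `qfun` on `r > 0`. -/
def qfunDerivTwo (σ α β γ r : ℝ) : ℝ :=
  2 * γ * (2*γ - 1)^2 * (4*γ - 3) * σ^2 * (r ^ (2*γ))^2 / r^4
    + 2*γ * (2*γ - 1) * (2*γ - 2) * α * r ^ (2*γ) / r^3
    + 4*γ^2 * (2*γ - 1) * β * r ^ (2*γ) / r^2

lemma hasDerivAt_qfun (σ α β γ : ℝ) {r : ℝ} (hr : 0 < r) :
    HasDerivAt (qfun σ α β γ) (qfunDeriv σ α β γ r) r := by
  have hu := hasDerivAt_rpow_two_mul γ hr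
  have hi := hasDerivAt_id r
  have hv := hu.div hi hr.ne'
  have h := ((hv.pow 2).const_mul (γ * (2*γ - 1) * σ^2)).add
    ((hv.const_mul (2*γ)).mul ((hi.const_mul β).const_add α))
  refine (h.congr_deriv ?_).congr_of_eventuallyEq ?_
  · simp only [qfunDeriv, id, Pi.div_apply, Nat.add_one_sub_one, pow_one]
    push_cast
    field_simp
    ring
  · filter_upwards [lt_mem_nhds hr] with x hx
    exact qfun_eq σ α β γ hx

lemma hasDerivAt_qfunDeriv (σ α β γ : ℝ) {r : ℝ} (hr : 0 < r) :
    HasDerivAt (qfunDeriv σ α β γ) (qfunDerivTwo σ α β γ r) r := by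
  have hu := hasDerivAt_rpow_two_mul γ hr
  have hi := hasDerivAt_id r
  have h := ((((hu.pow 2).const_mul (2 * γ * (2*γ - 1)^2 * σ^2)).div (hi.pow 3)
      (pow_ne_zero 3 hr.ne')).add
    ((hu.const_mul (2*γ * (2*γ - 1) * α)).div (hi.pow 2) (pow_ne_zero 2 hr.ne'))).add
    ((hu.const_mul (4*γ^2 * β)).div hi hr.ne')
  refine h.congr_deriv ?_
  simp only [qfunDerivTwo, id, Pi.pow_apply]
  field_simp
  push_cast
  ring

lemma pTau_lnPap (σ α : ℝ) {β : ℝ} (hβ : β ≠ 0) (γ τ r : ℝ) :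
    pTau (lnPap σ α β γ) τ r = -r * (1 + β * Bfun β τ) - α * Bfun β τ
      + r ^ (2*γ) * (σ^2/2 * (Bfun β τ)^2) + qfun σ α β γ r * Gfun σ β τ := by
  have hB := hasDerivAt_Bfun hβ τ
  have h := (((hB.const_mul (-r)).add (((hasDerivAt_id τ).sub hB).const_mul (α/β))).add
    ((hasDerivAt_Gfun σ hβ τ).const_mul (r ^ (2*γ)))).add
    ((hasDerivAt_Hfun σ hβ τ).const_mul (qfun σ α β γ r))
  simp only [pTau, lnPap_eq]
  refine (h.congr_deriv ?_).deriv
  field_simp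
  ring

lemma pR_lnPap (σ α β γ τ : ℝ) {r : ℝ} (hr : 0 < r) :
    pR (lnPap σ α β γ) τ r = -Bfun β τ + 2*γ * r ^ (2*γ) / r * Gfun σ β τ
      + qfunDeriv σ α β γ r * Hfun σ β τ := by
  have h := ((((hasDerivAt_id r).neg.mul_const (Bfun β τ)).add_const
      ((α/β) * (τ - Bfun β τ))).add
    ((hasDerivAt_rpow_two_mul γ hr).mul_const (Gfun σ β τ))).add
    ((hasDerivAt_qfun σ α β γ hr).mul_const (Hfun σ β τ))
  simp only [pR, lnPap_eq]
  refine (h.congr_deriv ?_).deriv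
  ring

lemma pRR_lnPap (σ α β γ τ : ℝ) {r : ℝ} (hr : 0 < r) :
    pRR (lnPap σ α β γ) τ r = 2*γ * (2*γ - 1) * r ^ (2*γ) / r^2 * Gfun σ β τ
      + qfunDerivTwo σ α β γ r * Hfun σ β τ := by
  have h := (((((hasDerivAt_rpow_two_mul γ hr).const_mul (2*γ)).div (hasDerivAt_id r)
    hr.ne').mul_const (Gfun σ β τ)).const_add (-Bfun β τ)).add
    ((hasDerivAt_qfunDeriv σ α β γ hr).mul_const (Hfun σ β τ))
  refine ((h.congr_deriv ?_).congr_of_eventuallyEq ?_).deriv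
  · simp only [id]
    field_simp
  · filter_upwards [lt_mem_nhds hr] with x hx
    exact pR_lnPap σ α β γ τ hx

/-- The operator `½σ² r^{2γ} ∂²_r + (α + βr) ∂_r` applied to `qfun`. -/
def qfunDrift (σ α β γ r : ℝ) : ℝ :=
  (1/2) * σ^2 * r ^ (2*γ) * qfunDerivTwo σ α β γ r + (α + β*r) * qfunDeriv σ α β γ r

lemma residualFn_eq (σ α : ℝ) {β : ℝ} (hβ : β ≠ 0) (γ τ : ℝ) {r : ℝ} (hr : 0 < r) :
    residualFn σ α β γ τ r = qfunDrift σ α β γ r * Hfun σ β τ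
      - σ^2 * r ^ (2*γ) * Bfun β τ *
        (2*γ * r ^ (2*γ) / r * Gfun σ β τ + qfunDeriv σ α β γ r * Hfun σ β τ)
      + (1/2) * σ^2 * r ^ (2*γ) *
        (2*γ * r ^ (2*γ) / r * Gfun σ β τ + qfunDeriv σ α β γ r * Hfun σ β τ)^2 := by
  rw [residualFn, pTau_lnPap σ α hβ, pR_lnPap σ α β γ τ hr, pRR_lnPap σ α β γ τ hr,
    qfun_eq σ α β γ hr, qfunDrift]
  field_simp
  ring

lemma rpow_two_mul_sub_two {r : ℝ} (hr : 0 < r) (γ : ℝ) :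
    r ^ (2*(γ - 2)) = r ^ (2*γ) / r^4 := by
  rw [show 2*(γ - 2) = 2*γ - (4 : ℕ) by push_cast; ring, rpow_sub hr, rpow_natCast]

lemma rpow_four_mul {r : ℝ} (hr : 0 < r) (γ : ℝ) : r ^ (4*γ) = (r ^ (2*γ))^2 := by
  rw [← rpow_two, ← rpow_mul hr.le]
  ring_nf

lemma rpow_two_mul_one_add {r : ℝ} (hr : 0 < r) (γ : ℝ) :
    r ^ (2*(1 + γ)) = r^2 * r ^ (2*γ) := by
  rw [mul_add, mul_one, rpow_add hr, rpow_two]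

lemma k4_eq (σ α β γ : ℝ) {r : ℝ} (hr : 0 < r) :
    k4 σ α β γ r = σ^2 * qfunDrift σ α β γ r / 24
      - σ^4 * r ^ (2*γ) * (2*γ * r ^ (2*γ) / r) / 6 := by
  have h3 : r ^ (3 + 2*γ) = r^3 * r ^ (2*γ) := by
    rw [rpow_add hr]
    norm_cast
  rw [k4, rpow_two_mul_sub_two hr, rpow_four_mul hr, rpow_two_mul_one_add hr, h3,
    qfunDrift, qfunDeriv, qfunDerivTwo]
  field_simp
  ring

lemma k5_eq (σ α β γ : ℝ) {r : ℝ} (hr : 0 < r) :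
    k5 σ α β γ r = σ^2 * β * qfunDrift σ α β γ r / 40
      - σ^4 * r ^ (2*γ) *
        (5 * β * (2*γ * r ^ (2*γ) / r) + qfunDeriv σ α β γ r) / 24 := by
  have h1 : r ^ (1 + 4*γ) = r * (r ^ (2*γ))^2 := by
    rw [rpow_add hr, rpow_one, rpow_four_mul hr]
  have h2 : r ^ (1 + 2*γ) = r * r ^ (2*γ) := by
    rw [rpow_add hr, rpow_one]
  rw [k5, rpow_two_mul_sub_two hr, rpow_two_mul_one_add hr, h1, h2,
    qfunDrift, qfunDeriv, qfunDerivTwo]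
  field_simp
  ring

lemma residualFn_sub_eq (σ α : ℝ) {β : ℝ} (hβ : β ≠ 0) (γ τ : ℝ) {r : ℝ} (hr : 0 < r) :
    residualFn σ α β γ τ r - k4 σ α β γ r * τ^4 - k5 σ α β γ r * τ^5 =
      qfunDrift σ α β γ r * (Hfun σ β τ - σ^2 * (τ^4/24 + β * τ^5/40))
      + -(σ^2 * r ^ (2*γ) * (2*γ * r ^ (2*γ) / r)) *
        (Bfun β τ * Gfun σ β τ - σ^2 * (τ^4/6 + 5 * β * τ^5/24))
      + -(σ^2 * r ^ (2*γ) * qfunDeriv σ α β γ r) *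
        (Bfun β τ * Hfun σ β τ - σ^2 * (τ^5/24))
      + (1/2) * σ^2 * r ^ (2*γ) * (2*γ * r ^ (2*γ) / r)^2 * (Gfun σ β τ * Gfun σ β τ)
      + σ^2 * r ^ (2*γ) * (2*γ * r ^ (2*γ) / r) * qfunDeriv σ α β γ r *
        (Gfun σ β τ * Hfun σ β τ)
      + (1/2) * σ^2 * r ^ (2*γ) * qfunDeriv σ α β γ r ^ 2 * (Hfun σ β τ * Hfun σ β τ) := by
  rw [residualFn_eq σ α hβ γ τ hr, k4_eq σ α β γ hr, k5_eq σ α β γ hr]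
  ring

/-- If `F(τ,r) = c(r) E(τ)` with `c` continuous on a compact set and `E = O(g)`, then `F` is
`O(g)` uniformly in `r`. -/
lemma exists_isBigO_bound_mul {c E g : ℝ → ℝ} {K : Set ℝ} {l : Filter ℝ} (hK : IsCompact K)
    (hc : ContinuousOn c K) (hE : E =O[l] g) :
    ∃ b : ℝ → ℝ, b =O[l] g ∧ ∀ τ, ∀ r ∈ K, |c r * E τ| ≤ b τ := by
  obtain ⟨M, hM⟩ := hK.exists_bound_of_continuousOn hc
  refine ⟨fun τ => M * |E τ|, hE.abs_left.const_mul_left M, fun τ r hr => ?_⟩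
  rw [abs_mul]
  exact mul_le_mul_of_nonneg_right (hM r hr) (abs_nonneg _)

/-- `h(τ,r) = k₄(r) τ⁴ + k₅(r) τ⁵ + o(τ⁵)` as `τ → 0⁺`,
uniformly with respect to `r` on compact subintervals `[r₁,r₂] ⊂ (0,∞)`. -/
theorem residual_asymptotics (σ α β γ : ℝ) (hσ : 0 < σ) (hα : 0 < α) (hβ : β ≠ 0)
    (hγ : 0 ≤ γ) (r₁ r₂ : ℝ) (hr₁ : 0 < r₁) (hr₁₂ : r₁ ≤ r₂) :
    (fun τ => ⨆ r ∈ Icc r₁ r₂,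
        |residualFn σ α β γ τ r - k4 σ α β γ r * τ^4 - k5 σ α β γ r * τ^5|)
      =o[𝓝[>] (0:ℝ)] (fun τ => τ^5) := by
  have hpos : ∀ r ∈ Icc r₁ r₂, 0 < r := fun r hr => hr₁.trans_le hr.1
  have hne : ∀ r ∈ Icc r₁ r₂, r ≠ 0 := fun r hr => (hpos r hr).ne'
  have hu : ContinuousOn (fun r : ℝ => r ^ (2*γ)) (Icc r₁ r₂) := fun r hr =>
    (hasDerivAt_rpow_two_mul γ (hpos r hr)).continuousAt.continuousWithinAt
  have hu' : ContinuousOn (fun r : ℝ => 2*γ * r ^ (2*γ) / r) (Icc r₁ r₂) :=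
    (hu.const_mul _).div continuousOn_id hne
  have hq' : ContinuousOn (qfunDeriv σ α β γ) (Icc r₁ r₂) := fun r hr =>
    (hasDerivAt_qfunDeriv σ α β γ (hpos r hr)).continuousAt.continuousWithinAt
  have hq'' : ContinuousOn (qfunDerivTwo σ α β γ) (Icc r₁ r₂) :=
    (((hu.pow 2).const_mul _).div (continuousOn_id.pow 4) fun r hr => pow_ne_zero 4 (hne r hr)).add
      ((hu.const_mul _).div (continuousOn_id.pow 3) fun r hr => pow_ne_zero 3 (hne r hr)) |>.add
      ((hu.const_mul _).div (continuousOn_id.pow 2) fun r hr => pow_ne_zero 2 (hne r hr))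
  have hL : ContinuousOn (qfunDrift σ α β γ) (Icc r₁ r₂) :=
    ((hu.const_mul _).mul hq'').add (((continuousOn_id.const_mul β).const_add α).mul hq')
  have hG := Gfun_isBigO σ hβ
  have hH := Hfun_isBigO σ hβ
  obtain ⟨b₁, hb₁, h₁⟩ := exists_isBigO_bound_mul isCompact_Icc hL (Hfun_sub_isBigO σ hβ)
  obtain ⟨b₂, hb₂, h₂⟩ := exists_isBigO_bound_mul isCompact_Icc
    ((hu.const_mul (σ^2)).mul hu').neg (Bfun_mul_Gfun_sub_isBigO σ hβ)
  obtain ⟨b₃, hb₃, h₃⟩ := exists_isBigO_bound_mul isCompact_Icc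
    ((hu.const_mul (σ^2)).mul hq').neg (Bfun_mul_Hfun_sub_isBigO σ hβ)
  obtain ⟨b₄, hb₄, h₄⟩ := exists_isBigO_bound_mul isCompact_Icc
    ((hu.const_mul ((1/2) * σ^2)).mul (hu'.pow 2))
    (isBigO_mul_pow (c := 6) hG hG (by norm_num))
  obtain ⟨b₅, hb₅, h₅⟩ := exists_isBigO_bound_mul isCompact_Icc
    (((hu.const_mul (σ^2)).mul hu').mul hq')
    (isBigO_mul_pow (c := 6) hG hH (by norm_num))
  obtain ⟨b₆, hb₆, h₆⟩ := exists_isBigO_bound_mul isCompact_Icc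
    ((hu.const_mul ((1/2) * σ^2)).mul (hq'.pow 2))
    (isBigO_mul_pow (c := 6) hH hH (by norm_num))
  have hb := ((((hb₁.add hb₂).add hb₃).add hb₄).add hb₅).add hb₆
  have hbound : ∀ τ, ∀ r ∈ Icc r₁ r₂,
      |residualFn σ α β γ τ r - k4 σ α β γ r * τ^4 - k5 σ α β γ r * τ^5|
        ≤ b₁ τ + b₂ τ + b₃ τ + b₄ τ + b₅ τ + b₆ τ := fun τ r hr => by
    rw [residualFn_sub_eq σ α hβ γ τ (hpos r hr)]
    refine (abs_add_le _ _).trans (add_le_add ?_ (h₆ τ r hr))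
    refine (abs_add_le _ _).trans (add_le_add ?_ (h₅ τ r hr))
    refine (abs_add_le _ _).trans (add_le_add ?_ (h₄ τ r hr))
    refine (abs_add_le _ _).trans (add_le_add ?_ (h₃ τ r hr))
    exact (abs_add_le _ _).trans (add_le_add (h₁ τ r hr) (h₂ τ r hr))
  have hsmall : (fun τ : ℝ => τ ^ 6) =o[𝓝 0] fun τ => τ ^ 5 :=
    isLittleO_pow_pow (by norm_num)
  refine IsLittleO.mono ?_ nhdsWithin_le_nhds
  refine (IsBigO.of_norm_le fun τ => ?_).trans_isLittleO (hb.trans_isLittleO hsmall)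
  have hnonneg : 0 ≤ b₁ τ + b₂ τ + b₃ τ + b₄ τ + b₅ τ + b₆ τ :=
    (abs_nonneg _).trans (hbound τ r₁ (left_mem_Icc.2 hr₁₂))
  rw [Real.norm_of_nonneg (Real.iSup_nonneg fun r => Real.iSup_nonneg fun _ => abs_nonneg _)]
  exact Real.iSup_le (fun r => Real.iSup_le (hbound τ r) hnonneg) hnonneg
end
end

section
/- Let P be a complete solution of the bond pricing PDE and let ω > 0 satisfy 2γ + ω − 1 > 0. Then for every τ ∈ (0,T) all the integrals below are finite and (1/2)(d/dτ) ∫₀^∞ r^ω P(τ,r)² dr = (σ²/4)(2γ+ω)(2γ+ω−1) ∫₀^∞ r^{2γ+ω−2} P(τ,r)² dr − (σ²/2) ∫₀^∞ r^{2γ+ω} (∂_rP(τ,r))² dr − (αω/2) ∫₀^∞ r^{ω−1} P(τ,r)² dr − ((ω+1)β/2) ∫₀^∞ r^ω P(τ,r)² dr − ∫₀^∞ r^{ω+1} P(τ,r)² dr. -/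
open Set MeasureTheory Real Filter Topology Asymptotics

noncomputable section

namespace IsCompleteSolution

variable {σ α β γ T : ℝ} {P : ℝ → ℝ → ℝ}

theorem hasDerivAt_tau (hP : IsCompleteSolution σ α β γ T P) {t r : ℝ} (ht : t ∈ Ioo 0 T)
    (hr : 0 ≤ r) : HasDerivAt (fun s => P s r) (pTau P t r) t :=
  (hP.diff_tau t ht r hr).hasDerivAt

theorem hasDerivAt_r (hP : IsCompleteSolution σ α β γ T P) {t r : ℝ} (ht : t ∈ Ioo 0 T)
    (hr : 0 ≤ r) : HasDerivAt (P t) (pR P t r) r :=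
  (hP.diff_r t ht r hr).hasDerivAt

theorem hasDerivAt_rr (hP : IsCompleteSolution σ α β γ T P) {t r : ℝ} (ht : t ∈ Ioo 0 T)
    (hr : 0 ≤ r) : HasDerivAt (pR P t) (pRR P t r) r :=
  (hP.diff_rr t ht r hr).hasDerivAt

theorem continuousOn (hP : IsCompleteSolution σ α β γ T P) {t : ℝ} (ht : t ∈ Ioo 0 T) :
    ContinuousOn (P t) (Ici 0) :=
  fun _ hr => (hP.hasDerivAt_r ht hr).continuousAt.continuousWithinAt

theorem continuousOn_pR (hP : IsCompleteSolution σ α β γ T P) {t : ℝ} (ht : t ∈ Ioo 0 T) :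
    ContinuousOn (pR P t) (Ici 0) :=
  fun _ hr => (hP.hasDerivAt_rr ht hr).continuousAt.continuousWithinAt

theorem continuousOn_pRR (hP : IsCompleteSolution σ α β γ T P) {t : ℝ} (ht : t ∈ Ioo 0 T) :
    ContinuousOn (pRR P t) (Ici 0) :=
  hP.cont_rr.comp (by fun_prop : ContinuousOn (fun r : ℝ => (t, r)) (Ici 0)) fun _ hr => ⟨ht, hr⟩

theorem continuousOn_pTau (hP : IsCompleteSolution σ α β γ T P) {t : ℝ} (ht : t ∈ Ioo 0 T) :
    ContinuousOn (pTau P t) (Ici 0) :=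
  hP.cont_tau.comp (by fun_prop : ContinuousOn (fun r : ℝ => (t, r)) (Ici 0)) fun _ hr => ⟨ht, hr⟩

/-- Near a time `t`, the derivative `∂_τ P` is bounded on compact ranges of `r`. -/
theorem exists_pTau_bound (hP : IsCompleteSolution σ α β γ T P) {t : ℝ} (ht : t ∈ Ioo 0 T)
    {x : ℝ} (hx : 0 ≤ x) (y : ℝ) :
    ∃ ε > 0, ∃ C, Metric.ball t ε ⊆ Ioo 0 T ∧
      ∀ s ∈ Metric.ball t ε, ∀ r ∈ Icc x y, |pTau P s r| ≤ C := by
  obtain ⟨ε, hε, hsub⟩ := Metric.nhds_basis_closedBall.mem_iff.1 (Ioo_mem_nhds ht.1 ht.2)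
  have hK := (isCompact_closedBall t ε).prod (isCompact_Icc (a := x) (b := y))
  obtain ⟨C, hC⟩ := hK.exists_bound_of_continuousOn
    (hP.cont_tau.mono (prod_mono hsub fun r hr => hx.trans hr.1))
  exact ⟨ε, hε, C, Metric.ball_subset_closedBall.trans hsub, fun s hs r hr =>
    hC (s, r) ⟨Metric.ball_subset_closedBall hs, hr⟩⟩

/-- Near a time `t`, the derivatives `∂_r P` and `∂²_r P` are bounded on compact ranges of `r`. -/
theorem exists_pR_pRR_bound (hP : IsCompleteSolution σ α β γ T P) {t : ℝ} (ht : t ∈ Ioo 0 T)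
    {x : ℝ} (hx : 0 ≤ x) (y : ℝ) :
    ∃ ε > 0, ∃ C, Metric.ball t ε ⊆ Ioo 0 T ∧
      ∀ s ∈ Metric.ball t ε, ∀ r ∈ Icc x y, |pR P s r| ≤ C ∧ |pRR P s r| ≤ C := by
  obtain ⟨ε, hε, hsub⟩ := Metric.nhds_basis_closedBall.mem_iff.1 (Ioo_mem_nhds ht.1 ht.2)
  have hK := (isCompact_closedBall t ε).prod (isCompact_Icc (a := x) (b := y))
  have hKsub : Metric.closedBall t ε ×ˢ Icc x y ⊆ Ioo 0 T ×ˢ Ici 0 :=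
    prod_mono hsub fun r hr => hx.trans hr.1
  obtain ⟨C, hC⟩ := hK.exists_bound_of_continuousOn (hP.cont_r.mono hKsub)
  obtain ⟨C', hC'⟩ := hK.exists_bound_of_continuousOn (hP.cont_rr.mono hKsub)
  have hb := Metric.ball_subset_closedBall (x := t) (ε := ε)
  exact ⟨ε, hε, max C C', hb.trans hsub, fun s hs r hr =>
    ⟨(hC (s, r) ⟨hb hs, hr⟩).trans (le_max_left _ _),
      (hC' (s, r) ⟨hb hs, hr⟩).trans (le_max_right _ _)⟩⟩

/-- Differentiation in time of a weighted `L²` norm of `P` over a compact interval. -/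
theorem hasDerivAt_integral_mul_sq (hP : IsCompleteSolution σ α β γ T P) {t : ℝ}
    (ht : t ∈ Ioo 0 T) {x y : ℝ} (hx : 0 < x) (hxy : x ≤ y) {w : ℝ → ℝ}
    (hw : ContinuousOn w (Icc x y)) :
    HasDerivAt (fun s => ∫ r in x..y, w r * P s r ^ 2)
      (∫ r in x..y, w r * (2 * P t r * pTau P t r)) t := by
  obtain ⟨ε, hε, C, hsub, hC⟩ := hP.exists_pTau_bound ht hx.le y
  obtain ⟨M, m, δ, hM, hm, hδ, hg⟩ := hP.growth
  obtain ⟨W, hW⟩ := isCompact_Icc.exists_bound_of_continuousOn hw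
  have hPM : ∀ s ∈ Ioo 0 T, ∀ r ∈ Icc x y, |P s r| ≤ M := fun s hs r hr => by
    have hr0 := hx.trans_le hr.1
    refine (hg s hs r hr0).1.trans (mul_le_of_le_one_right hM.le (exp_le_one_iff.2 ?_))
    have := rpow_nonneg hr0.le δ
    nlinarith
  have hI : Icc x y ⊆ Ici 0 := fun r hr => hx.le.trans hr.1
  have hcont : ∀ s ∈ Ioo 0 T, ContinuousOn (fun r => w r * P s r ^ 2) (Icc x y) := fun s hs =>
    hw.mul (((hP.continuousOn hs).mono hI).pow 2)
  have hcont' : ContinuousOn (fun r => w r * (2 * P t r * pTau P t r)) (Icc x y) :=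
    hw.mul ((continuousOn_const.mul ((hP.continuousOn ht).mono hI)).mul
      ((hP.continuousOn_pTau ht).mono hI))
  have hu : uIcc x y = Icc x y := uIcc_of_le hxy
  have hu' : uIoc x y ⊆ Icc x y := by rw [uIoc_of_le hxy]; exact Ioc_subset_Icc_self
  refine (intervalIntegral.hasDerivAt_integral_of_dominated_loc_of_deriv_le
    (F' := fun s r => w r * (2 * P s r * pTau P s r)) (bound := fun _ => W * (2 * M * C))
    (Metric.ball_mem_nhds t hε) ?_ ?_ ?_ ?_ intervalIntegrable_const ?_).2
  · filter_upwards [Ioo_mem_nhds ht.1 ht.2] with s hs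
    exact ((hcont s hs).mono hu').aestronglyMeasurable measurableSet_uIoc
  · exact ContinuousOn.intervalIntegrable (hu ▸ hcont t ht)
  · exact (hcont'.mono hu').aestronglyMeasurable measurableSet_uIoc
  · refine .of_forall fun r hr s hs => ?_
    have hr' := hu' hr
    have h1 := hPM s (hsub hs) r hr'
    have h2 := hC s hs r hr'
    have h3 := hW r hr'
    rw [norm_eq_abs] at h3 ⊢
    rw [abs_mul, abs_mul, abs_mul, abs_two]
    gcongr
    exact (abs_nonneg _).trans h3
  · refine .of_forall fun r hr s hs => ?_
    have := ((hP.hasDerivAt_tau (hsub hs) (hI (hu' hr))).pow 2).const_mul (w r)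
    simpa using this

/-- Differentiation in time of a localized `L²` norm of `∂_r P`; only one derivative of `P` in
time is needed, since the localizing weight vanishes at the endpoints. -/
theorem hasDerivAt_integral_mul_pR_sq (hP : IsCompleteSolution σ α β γ T P) {t : ℝ}
    (ht : t ∈ Ioo 0 T) {x y : ℝ} (hx : 0 ≤ x) (hxy : x ≤ y) {ψ ψ' : ℝ → ℝ}
    (hψ : ∀ r, HasDerivAt ψ (ψ' r) r) (hψ' : Continuous ψ') (hψx : ψ x = 0) (hψy : ψ y = 0) :
    HasDerivAt (fun s => ∫ r in x..y, ψ r * pR P s r ^ 2)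
      (∫ r in x..y, -2 * pTau P t r * (ψ r * pRR P t r + ψ' r * pR P t r)) t := by
  obtain ⟨ε, hε, C, hsub, hC⟩ := hP.exists_pTau_bound ht hx y
  obtain ⟨ε₁, hε₁, D, hsub₁, hD⟩ := hP.exists_pR_pRR_bound ht hx y
  have hψc : Continuous ψ := continuous_iff_continuousAt.2 fun r => (hψ r).continuousAt
  obtain ⟨W, hW⟩ := isCompact_Icc.exists_bound_of_continuousOn (hψc.continuousOn (s := Icc x y))
  obtain ⟨W', hW'⟩ := isCompact_Icc.exists_bound_of_continuousOn (hψ'.continuousOn (s := Icc x y))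
  have hI : Icc x y ⊆ Ici 0 := fun r hr => hx.trans hr.1
  have hu : uIcc x y = Icc x y := uIcc_of_le hxy
  have hu' : uIoc x y ⊆ Icc x y := by rw [uIoc_of_le hxy]; exact Ioc_subset_Icc_self
  have hc0 : ∀ s ∈ Ioo 0 T, ContinuousOn (P s) (Icc x y) := fun s hs => (hP.continuousOn hs).mono hI
  have hc1 : ∀ s ∈ Ioo 0 T, ContinuousOn (pR P s) (Icc x y) :=
    fun s hs => (hP.continuousOn_pR hs).mono hI
  have hc2 : ∀ s ∈ Ioo 0 T, ContinuousOn (pRR P s) (Icc x y) :=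
    fun s hs => (hP.continuousOn_pRR hs).mono hI
  have hψI := hψc.continuousOn (s := Icc x y)
  have hψI' := hψ'.continuousOn (s := Icc x y)
  have parts : ∀ s ∈ Ioo 0 T, (∫ r in x..y, ψ r * pR P s r ^ 2) - ∫ r in x..y, ψ r * pR P t r ^ 2 =
      ∫ r in x..y, -((P s r - P t r) *
        (ψ' r * (pR P s r + pR P t r) + ψ r * (pRR P s r + pRR P t r))) := by
    intro s hs
    have i1 : IntervalIntegrable (fun r => ψ r * pR P s r ^ 2) volume x y :=
      ContinuousOn.intervalIntegrable (hu ▸ hψI.mul ((hc1 s hs).pow 2))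
    have i2 : IntervalIntegrable (fun r => ψ r * pR P t r ^ 2) volume x y :=
      ContinuousOn.intervalIntegrable (hu ▸ hψI.mul ((hc1 t ht).pow 2))
    have i3 : IntervalIntegrable (fun r => (P s r - P t r) *
        (ψ' r * (pR P s r + pR P t r) + ψ r * (pRR P s r + pRR P t r))) volume x y :=
      ContinuousOn.intervalIntegrable (hu ▸ ((hc0 s hs).sub (hc0 t ht)).mul
        ((hψI'.mul ((hc1 s hs).add (hc1 t ht))).add (hψI.mul ((hc2 s hs).add (hc2 t ht)))))
    rw [← intervalIntegral.integral_sub i1 i2, intervalIntegral.integral_neg,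
      eq_neg_iff_add_eq_zero,
      ← intervalIntegral.integral_add (i1.sub i2) i3]
    have := intervalIntegral.integral_eq_sub_of_hasDerivAt (a := x) (b := y)
      (f := fun r => (P s r - P t r) * (ψ r * (pR P s r + pR P t r)))
      (f' := fun r => (ψ r * pR P s r ^ 2 - ψ r * pR P t r ^ 2) + (P s r - P t r) *
        (ψ' r * (pR P s r + pR P t r) + ψ r * (pRR P s r + pRR P t r))) ?_ ((i1.sub i2).add i3)
    · rw [this, hψx, hψy]; ring
    · intro r hr
      have hr0 := hI (hu ▸ hr)
      refine (((hP.hasDerivAt_r hs hr0).sub (hP.hasDerivAt_r ht hr0)).mul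
        ((hψ r).mul ((hP.hasDerivAt_rr hs hr0).add (hP.hasDerivAt_rr ht hr0)))).congr_deriv ?_
      simp only [Pi.add_apply, Pi.sub_apply, Pi.mul_apply]
      ring
  rw [hasDerivAt_iff_tendsto_slope]
  have hlim : Tendsto (fun s => ∫ r in x..y, -(slope (fun z => P z r) t s *
      (ψ' r * (pR P s r + pR P t r) + ψ r * (pRR P s r + pRR P t r)))) (𝓝[≠] t)
      (𝓝 (∫ r in x..y, -2 * pTau P t r * (ψ r * pRR P t r + ψ' r * pR P t r))) := by
    refine intervalIntegral.tendsto_integral_filter_of_dominated_convergence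
      (fun _ => C * (W' * (D + D) + W * (D + D))) ?_ ?_ intervalIntegrable_const ?_
    · filter_upwards [nhdsWithin_le_nhds (Ioo_mem_nhds ht.1 ht.2)] with s hs
      refine (ContinuousOn.mono ?_ hu').aestronglyMeasurable measurableSet_uIoc
      simp only [slope_def_field]
      exact ((((hc0 s hs).sub (hc0 t ht)).div_const _).mul
        ((hψI'.mul ((hc1 s hs).add (hc1 t ht))).add (hψI.mul ((hc2 s hs).add (hc2 t ht))))).neg
    · filter_upwards [nhdsWithin_le_nhds (Metric.ball_mem_nhds t hε),
        nhdsWithin_le_nhds (Metric.ball_mem_nhds t hε₁), self_mem_nhdsWithin] with s hs hs₁ hst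
      refine .of_forall fun r hr => ?_
      have hr' := hu' hr
      have hsl : |slope (fun z => P z r) t s| ≤ C := by
        rw [slope_def_field, abs_div, div_le_iff₀ (abs_pos.2 (sub_ne_zero.2 hst))]
        exact (convex_ball t ε).norm_image_sub_le_of_norm_hasDerivWithin_le
          (fun z hz => (hP.hasDerivAt_tau (hsub hz) (hI hr')).hasDerivWithinAt)
          (fun z hz => hC z hz r hr') (Metric.mem_ball_self hε) hs
      obtain ⟨a1, a2⟩ := hD s hs₁ r hr'
      obtain ⟨b1, b2⟩ := hD t (Metric.mem_ball_self hε₁) r hr'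
      have h3 := hW r hr'
      have h4 := hW' r hr'
      rw [norm_eq_abs] at h3 h4
      have hC0 := (abs_nonneg _).trans hsl
      have hW0 := (abs_nonneg _).trans h3
      have hW0' := (abs_nonneg _).trans h4
      rw [norm_neg, norm_eq_abs, abs_mul]
      gcongr
      refine (abs_add_le _ _).trans ?_
      rw [abs_mul, abs_mul]
      gcongr
      · exact (abs_add_le _ _).trans (add_le_add a1 b1)
      · exact (abs_add_le _ _).trans (add_le_add a2 b2)
    · refine .of_forall fun r hr => ?_
      have hr' := hu' hr
      have e1 := (hP.hasDerivAt_tau ht (hI hr')).tendsto_slope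
      have hmem : ((t, r) : ℝ × ℝ) ∈ Ioo 0 T ×ˢ Ici 0 := ⟨ht, hI hr'⟩
      have hpath : Tendsto (fun s : ℝ => (s, r)) (𝓝[≠] t) (𝓝[Ioo 0 T ×ˢ Ici 0] (t, r)) := by
        refine tendsto_nhdsWithin_iff.2 ⟨?_, ?_⟩
        · exact ((Continuous.prodMk_left r).tendsto t).mono_left nhdsWithin_le_nhds
        · filter_upwards [nhdsWithin_le_nhds (Ioo_mem_nhds ht.1 ht.2)] with s hs
          exact ⟨hs, hI hr'⟩
      have e2 : Tendsto (fun s => pR P s r) (𝓝[≠] t) (𝓝 (pR P t r)) :=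
        (hP.cont_r _ hmem).tendsto.comp hpath
      have e3 : Tendsto (fun s => pRR P s r) (𝓝[≠] t) (𝓝 (pRR P t r)) :=
        (hP.cont_rr _ hmem).tendsto.comp hpath
      have := (e1.mul (((e2.add_const (pR P t r)).const_mul (ψ' r)).add
        ((e3.add_const (pRR P t r)).const_mul (ψ r)))).neg
      convert this using 2
      ring
  refine hlim.congr' ?_
  filter_upwards [nhdsWithin_le_nhds (Ioo_mem_nhds ht.1 ht.2), self_mem_nhdsWithin] with s hs hst
  rw [slope_def_field, parts s hs, ← intervalIntegral.integral_div]
  congr 1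
  ext r
  rw [slope_def_field]
  ring

end IsCompleteSolution

/-- If `E' ≤ c` and `E = K - F'` with `K ≤ k` and `|F| ≤ f` on `[t - h, t]`, then `E t` is small. -/
theorem le_of_hasDerivAt_of_hasDerivAt_sub {E E' F K : ℝ → ℝ} {t h c k f : ℝ} (hh : 0 < h)
    (hc : 0 ≤ c) (hE : ∀ s ∈ Icc (t - h) t, HasDerivAt E (E' s) s)
    (hF : ∀ s ∈ Icc (t - h) t, HasDerivAt F (K s - E s) s)
    (hE' : ∀ s ∈ Icc (t - h) t, E' s ≤ c) (hK : ∀ s ∈ Icc (t - h) t, K s ≤ k)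
    (hf : ∀ s ∈ Icc (t - h) t, |F s| ≤ f) : E t ≤ k + c * h + 2 * f / h := by
  obtain ⟨s, hs, hFs⟩ := exists_hasDerivAt_eq_slope F (fun s => K s - E s) (sub_lt_self t hh)
    (fun s hs => (hF s hs).continuousAt.continuousWithinAt)
    (fun s hs => hF s (Ioo_subset_Icc_self hs))
  obtain ⟨z, hz, hEz⟩ := exists_hasDerivAt_eq_slope E E' hs.2
    (fun z hz => (hE z ⟨hs.1.le.trans hz.1, hz.2⟩).continuousAt.continuousWithinAt)
    (fun z hz => hE z ⟨hs.1.le.trans hz.1.le, hz.2.le⟩)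
  have h1 := (abs_le.1 (hf t ⟨by linarith, le_rfl⟩)).1
  have h2 := (abs_le.1 (hf (t - h) ⟨le_rfl, by linarith⟩)).2
  have h3 := hK s (Ioo_subset_Icc_self hs)
  have h4 := hE' z ⟨hs.1.le.trans hz.1.le, hz.2.le⟩
  have h5 : -(2 * f / h) ≤ K s - E s := by
    rw [hFs, sub_sub_cancel, ← neg_div]
    gcongr
    linarith
  rw [eq_div_iff (sub_pos.2 hs.2).ne'] at hEz
  have h6 : E' z * (t - s) ≤ c * h :=
    mul_le_mul h4 (by linarith [hs.1]) (by linarith [hs.2]) hc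
  linarith

/-- For every exponent `j`, the function `exp (-m x ^ δ)` is `O(x ^ (-j))`. -/
theorem exists_exp_neg_mul_rpow_le {m δ : ℝ} (hm : 0 < m) (hδ : 0 < δ) (j : ℝ) :
    ∃ C > 0, ∀ x : ℝ, 1 ≤ x → Real.exp (-m * x ^ δ) ≤ C / x ^ j := by
  obtain ⟨n, hn⟩ := exists_nat_ge (j / δ)
  refine ⟨n.factorial / m ^ n, by positivity, fun x hx => ?_⟩
  have hx0 : 0 < x := by linarith
  have h1 := Real.pow_div_factorial_le_exp (x := m * x ^ δ) (by positivity) n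
  have h2 : x ^ j ≤ (x ^ δ) ^ n := by
    rw [← rpow_mul_natCast hx0.le]
    exact rpow_le_rpow_of_exponent_le hx (by rw [div_le_iff₀ hδ] at hn; linarith)
  rw [neg_mul, Real.exp_neg, inv_le_comm₀ (Real.exp_pos _) (by positivity)]
  refine le_trans ?_ h1
  rw [inv_div, div_div_eq_mul_div, mul_pow]
  gcongr ?_ / _
  rw [mul_comm]
  gcongr

namespace IsCompleteSolution

variable {σ α β γ T : ℝ} {P : ℝ → ℝ → ℝ}

/-- Interior gradient estimate: smallness of `P` on a cylinder forces smallness of the localized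
`L²` norm of `∂_r P`. -/
theorem integral_bump_mul_pR_sq_le (hP : IsCompleteSolution σ α β γ T P) {M e Λ κ x t h : ℝ}
    (hx : 0 < x) (hκ : 0 < κ) (hM : 0 < M)
    (hA : ∀ r ∈ Icc x (x + 3), κ ≤ 1 / 2 * σ ^ 2 * r ^ (2 * γ) ∧
      1 / 2 * σ ^ 2 * r ^ (2 * γ) ≤ Λ)
    (hQ : ∀ s ∈ Ioo 0 T, ∀ r ∈ Icc x (x + 3), |(α + β * r) * pR P s r - r * P s r| ≤ Λ)
    (hp : ∀ s ∈ Ioo 0 T, ∀ r ∈ Icc x (x + 3), |pR P s r| ≤ M)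
    (he : ∀ s ∈ Ioo 0 T, ∀ r ∈ Icc x (x + 3), |P s r| ≤ e)
    (ht : t ∈ Ioo 0 T) (hh : 0 < h) (hht : h < t) :
    ∫ r in x..(x + 3), ((r - x) * (x + 3 - r)) ^ 2 * pR P t r ^ 2 ≤
      3 * (18 * e * M + 9 * e * Λ / κ) + 3 * (36 * Λ * M ^ 2 + 9 * Λ ^ 2 / κ + 36 * Λ * M) * h
        + 27 * e ^ 2 / κ / h := by
  have hxy : x ≤ x + 3 := by linarith
  have hu : uIcc x (x + 3) = Icc x (x + 3) := uIcc_of_le hxy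
  have hI : Icc x (x + 3) ⊆ Ici 0 := fun r hr => hx.le.trans hr.1
  have hx3 : x ∈ Icc x (x + 3) := ⟨le_rfl, hxy⟩
  have hΛ : 0 < Λ := hκ.trans_le ((hA x hx3).1.trans (hA x hx3).2)
  have he0 : 0 ≤ e := (abs_nonneg _).trans (he t ht x hx3)
  set A : ℝ → ℝ := fun r => 1 / 2 * σ ^ 2 * r ^ (2 * γ) with hAdef
  set q : ℝ → ℝ := fun r => (r - x) * (x + 3 - r) with hq
  set q' : ℝ → ℝ := fun r => 2 * x + 3 - 2 * r with hq'
  have hqd : ∀ r, HasDerivAt q (q' r) r := fun r => by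
    refine (((hasDerivAt_id r).sub_const x).mul
      ((hasDerivAt_id r).const_sub (x + 3))).congr_deriv ?_
    simp only [hq', id]
    ring
  have hψd : ∀ r, HasDerivAt (fun r => q r ^ 2) (2 * q r * q' r) r := fun r => by
    have := (hqd r).fun_pow 2
    simpa using this
  have hqc : Continuous q := by fun_prop
  have hqc' : Continuous q' := by fun_prop
  have hq3 : ∀ r ∈ Icc x (x + 3), |q r| ≤ 3 := fun r hr => by
    simp only [hq]
    exact abs_le.2 ⟨by nlinarith [hr.1, hr.2], by nlinarith [sq_nonneg (2 * r - 2 * x - 3)]⟩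
  have hq3' : ∀ r ∈ Icc x (x + 3), |q' r| ≤ 3 := fun r hr =>
    abs_le.2 ⟨by simp only [hq']; linarith [hr.2], by simp only [hq']; linarith [hr.1]⟩
  have hAc : ContinuousOn A (Icc x (x + 3)) := fun r hr =>
    (continuousAt_const.mul (continuousAt_rpow_const r (2 * γ)
      (.inl (hx.trans_le hr.1).ne'))).continuousWithinAt
  have hApos : ∀ r ∈ Icc x (x + 3), 0 < A r := fun r hr => hκ.trans_le (hA r hr).1
  set Q : ℝ → ℝ → ℝ := fun s r => (α + β * r) * pR P s r - r * P s r with hQdef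
  have hpde : ∀ s ∈ Ioo 0 T, ∀ r ∈ Icc x (x + 3), pTau P s r = A r * pRR P s r + Q s r :=
    fun s hs r hr => by
      have := hP.pde s hs r (hx.trans_le hr.1)
      simp only [hAdef, hQdef]
      linarith
  have hsub : Icc (t - h) t ⊆ Ioo 0 T := fun s hs => ⟨by linarith [hs.1], hs.2.trans_lt ht.2⟩
  have hc0 : ∀ s ∈ Ioo 0 T, ContinuousOn (P s) (Icc x (x + 3)) :=
    fun s hs => (hP.continuousOn hs).mono hI
  have hc1 : ∀ s ∈ Ioo 0 T, ContinuousOn (pR P s) (Icc x (x + 3)) :=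
    fun s hs => (hP.continuousOn_pR hs).mono hI
  have hc2 : ∀ s ∈ Ioo 0 T, ContinuousOn (pRR P s) (Icc x (x + 3)) :=
    fun s hs => (hP.continuousOn_pRR hs).mono hI
  have hcT : ∀ s ∈ Ioo 0 T, ContinuousOn (pTau P s) (Icc x (x + 3)) :=
    fun s hs => (hP.continuousOn_pTau hs).mono hI
  have hcQ : ∀ s ∈ Ioo 0 T, ContinuousOn (Q s) (Icc x (x + 3)) := fun s hs => by
    have h0 := hc0 s hs
    have h1 := hc1 s hs
    fun_prop
  have hAq : ContinuousOn (fun r => q r ^ 2 / A r) (Icc x (x + 3)) :=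
    (hqc.continuousOn.pow 2).div hAc fun r hr => (hApos r hr).ne'
  have hle : ∀ (f : ℝ → ℝ) (B : ℝ), (ContinuousOn f (Icc x (x + 3))) →
      (∀ r ∈ Icc x (x + 3), f r ≤ B) → ∫ r in x..(x + 3), f r ≤ 3 * B := fun f B hf hB => by
    refine (intervalIntegral.integral_mono_on hxy (ContinuousOn.intervalIntegrable (hu ▸ hf))
      intervalIntegrable_const hB).trans_eq ?_
    simp
  have hdiv : ∀ r ∈ Icc x (x + 3), q r ^ 2 / A r ≤ 9 / κ := fun r hr =>
    div_le_div₀ (by norm_num) (by nlinarith [abs_le.1 (hq3 r hr)]) hκ (hA r hr).1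
  have key := le_of_hasDerivAt_of_hasDerivAt_sub (t := t) (h := h)
    (E := fun s => ∫ r in x..(x + 3), q r ^ 2 * pR P s r ^ 2)
    (E' := fun s => ∫ r in x..(x + 3),
      -2 * pTau P s r * (q r ^ 2 * pRR P s r + 2 * q r * q' r * pR P s r))
    (F := fun s => ∫ r in x..(x + 3), 1 / 2 * (q r ^ 2 / A r) * P s r ^ 2)
    (K := fun s => ∫ r in x..(x + 3),
      (-(2 * q r * q' r * P s r * pR P s r) + q r ^ 2 / A r * (P s r * Q s r)))
    (c := 3 * (36 * Λ * M ^ 2 + 9 * Λ ^ 2 / κ + 36 * Λ * M))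
    (k := 3 * (18 * e * M + 9 * e * Λ / κ))
    (f := 3 * (1 / 2 * (9 / κ) * e ^ 2)) hh (by positivity) ?_ ?_ ?_ ?_ ?_
  · refine key.trans_eq ?_
    field_simp
    ring
  · intro s hs
    exact hP.hasDerivAt_integral_mul_pR_sq (hsub hs) hx.le hxy hψd (by fun_prop)
      (by simp [hq]) (by simp [hq])
  · intro s hs
    have hs' := hsub hs
    refine (hP.hasDerivAt_integral_mul_sq hs' hx hxy (hAq.const_mul _)).congr_deriv ?_
    have h0 := hc0 s hs'
    have h1 := hc1 s hs'
    have h2 := hc2 s hs'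
    have hT := hcT s hs'
    have hQ' := hcQ s hs'
    have hqo := hqc.continuousOn (s := Icc x (x + 3))
    have hqo' := hqc'.continuousOn (s := Icc x (x + 3))
    have i1 : IntervalIntegrable (fun r => -(2 * q r * q' r * P s r * pR P s r) +
        q r ^ 2 / A r * (P s r * Q s r)) volume x (x + 3) :=
      ContinuousOn.intervalIntegrable (hu ▸ ((((((continuousOn_const.mul hqo).mul hqo').mul h0).mul
        h1).neg).add (hAq.mul (h0.mul hQ'))))
    have i2 : IntervalIntegrable (fun r => q r ^ 2 * pR P s r ^ 2) volume x (x + 3) :=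
      ContinuousOn.intervalIntegrable (hu ▸ ((hqo.pow 2).mul (h1.pow 2)))
    have i3 : IntervalIntegrable (fun r => 1 / 2 * (q r ^ 2 / A r) * (2 * P s r * pTau P s r))
        volume x (x + 3) :=
      ContinuousOn.intervalIntegrable (hu ▸ ((hAq.const_mul _).mul
        ((continuousOn_const.mul h0).mul hT)))
    rw [← intervalIntegral.integral_sub i1 i2, ← sub_eq_zero,
      ← intervalIntegral.integral_sub i3 (i1.sub i2)]
    rw [intervalIntegral.integral_eq_sub_of_hasDerivAt
      (f := fun r => q r ^ 2 * (P s r * pR P s r)) ?_ (i3.sub (i1.sub i2))]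
    · simp [hq]
    · intro r hr
      rw [hu] at hr
      have hr0 := hI hr
      refine ((hψd r).mul ((hP.hasDerivAt_r hs' hr0).mul
        (hP.hasDerivAt_rr hs' hr0))).congr_deriv ?_
      have := (hApos r hr).ne'
      rw [hpde s hs' r hr]
      simp only [Pi.mul_apply]
      field_simp
      ring
  · intro s hs
    have hs' := hsub hs
    have h1 := hc1 s hs'
    have h2 := hc2 s hs'
    have hT := hcT s hs'
    refine hle _ _ ((continuousOn_const.mul hT).mul (((hqc.continuousOn.pow 2).mul h2).add
      (((continuousOn_const.mul hqc.continuousOn).mul hqc'.continuousOn).mul h1))) fun r hr => ?_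
    rw [hpde s hs' r hr]
    obtain ⟨hA1, hA2⟩ : κ ≤ A r ∧ A r ≤ Λ := hA r hr
    have hAr := hApos r hr
    have a1 : A r * q' r ^ 2 * pR P s r ^ 2 ≤ Λ * 3 ^ 2 * M ^ 2 := by
      rw [← sq_abs (q' r), ← sq_abs (pR P s r)]
      gcongr
      exacts [hq3' r hr, hp s hs' r hr]
    have a2 : (Q s r) ^ 2 * q r ^ 2 / A r ≤ Λ ^ 2 * 3 ^ 2 / κ := by
      rw [← sq_abs (Q s r), ← sq_abs (q r)]
      gcongr
      exacts [hQ s hs' r hr, hq3 r hr]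
    have a3 : |Q s r * q r * q' r * pR P s r| ≤ Λ * 3 * 3 * M := by
      rw [abs_mul, abs_mul, abs_mul]
      gcongr
      exacts [hQ s hs' r hr, hq3 r hr, hq3' r hr, hp s hs' r hr]
    have a4 := (abs_le.1 a3).1
    have b1 : 0 ≤ A r * (q r * pRR P s r + 2 * q' r * pR P s r) ^ 2 := by positivity
    have b2 : 0 ≤ A r * (q r * pRR P s r + Q s r * q r / A r) ^ 2 := by positivity
    have b3 : A r * (q r * pRR P s r + Q s r * q r / A r) ^ 2 =
        A r * (q r * pRR P s r) ^ 2 + 2 * (q r * pRR P s r) * (Q s r * q r)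
          + (Q s r) ^ 2 * q r ^ 2 / A r := by
      field_simp
      ring
    have a5 : Λ ^ 2 * 3 ^ 2 / κ = 9 * Λ ^ 2 / κ := by ring
    linarith
  · intro s hs
    have hs' := hsub hs
    have h0 := hc0 s hs'
    have h1 := hc1 s hs'
    have hQ' := hcQ s hs'
    refine hle _ _ ((((((continuousOn_const.mul hqc.continuousOn).mul hqc'.continuousOn).mul h0).mul
        h1).neg).add (hAq.mul (h0.mul hQ'))) fun r hr => ?_
    have a1 : |q r * q' r * P s r * pR P s r| ≤ 3 * 3 * e * M := by
      rw [abs_mul, abs_mul, abs_mul]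
      gcongr
      exacts [hq3 r hr, hq3' r hr, he s hs' r hr, hp s hs' r hr]
    have a2 : q r ^ 2 / A r * (P s r * Q s r) ≤ 9 / κ * (e * Λ) := by
      refine mul_le_mul_of_nonneg (hdiv r hr)
        ((le_abs_self _).trans ((abs_mul _ _).trans_le ?_))
        (by have := hApos r hr; positivity) (by positivity)
      gcongr
      exacts [he s hs' r hr, hQ s hs' r hr]
    have a3 : 9 / κ * (e * Λ) = 9 * e * Λ / κ := by ring
    linarith [(abs_le.1 a1).1]
  · intro s hs
    have hs' := hsub hs
    have h0 := hc0 s hs'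
    rw [abs_of_nonneg (intervalIntegral.integral_nonneg hxy fun r hr => by
      have := hApos r hr
      positivity)]
    refine hle _ _ ((hAq.const_mul _).mul (h0.pow 2)) fun r hr => ?_
    have := hApos r hr
    rw [← sq_abs (P s r)]
    gcongr 1 / 2 * ?_ * ?_ ^ 2
    exacts [hdiv r hr, he s hs' r hr]

/-- The localized `L²` norm of `∂_r P` decays faster than any power of the position. -/
theorem exists_integral_bump_mul_pR_sq_le (hP : IsCompleteSolution σ α β γ T P) (hσ : 0 < σ)
    (hγ : 0 ≤ γ) {a : ℝ} (ha : 0 ≤ a) {t₁ : ℝ} (ht₁ : 0 < t₁) :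
    ∃ C, ∀ t ∈ Ioo t₁ T, ∀ x : ℝ, 1 ≤ x →
      x ^ (a + 2) * ∫ r in x..(x + 3), ((r - x) * (x + 3 - r)) ^ 2 * pR P t r ^ 2 ≤ C := by
  obtain ⟨M, m, δ, hM, hm, hδ, hg⟩ := hP.growth
  obtain ⟨D, hD, hexp⟩ := exists_exp_neg_mul_rpow_le hm hδ (2 * (2 * γ + 1) + 2 * (a + 2))
  set κ := 1 / 2 * σ ^ 2 with hκ
  have hκ0 : 0 < κ := by positivity
  set B := κ * 4 ^ (2 * γ) + ((|α| + 4 * |β|) * M + 4 * M) with hB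
  have hB0 : 0 < B := by positivity
  set c := M * D with hc
  have hc0 : 0 < c := by positivity
  refine ⟨3 * (18 * c * M + 9 * c * B / κ) +
    3 * (36 * B * M ^ 2 + 9 * B ^ 2 / κ + 36 * B * M) * (t₁ / 2) + 27 * c ^ 2 / κ / (t₁ / 2),
    fun t ht x hx => ?_⟩
  have hx0 : 0 < x := by linarith
  have htT : t ∈ Ioo 0 T := ⟨ht₁.trans ht.1, ht.2⟩
  set X := x ^ (2 * γ + 1) with hX
  set Y := x ^ (a + 2) with hY
  have hX1 : 1 ≤ X := one_le_rpow hx (by linarith)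
  have hY1 : 1 ≤ Y := one_le_rpow hx (by linarith)
  have hxX : x ≤ X := by
    simpa using rpow_le_rpow_of_exponent_le hx (by linarith : (1 : ℝ) ≤ 2 * γ + 1)
  have hxγ : x ^ (2 * γ) ≤ X := rpow_le_rpow_of_exponent_le hx (by linarith)
  have hj : x ^ (2 * (2 * γ + 1) + 2 * (a + 2)) = X ^ 2 * Y ^ 2 := by
    rw [rpow_add hx0, mul_comm 2 (2 * γ + 1), mul_comm 2 (a + 2), rpow_mul hx0.le,
      rpow_mul hx0.le, rpow_two, rpow_two]
  have hr1 : ∀ r ∈ Icc x (x + 3), 1 ≤ r ∧ r ≤ 4 * x := fun r hr =>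
    ⟨hx.trans hr.1, by linarith [hr.2]⟩
  have hPx : ∀ s ∈ Ioo 0 T, ∀ r ∈ Icc x (x + 3), |P s r| ≤ M * Real.exp (-m * x ^ δ) :=
    fun s hs r hr => by
      refine (hg s hs r (hx0.trans_le hr.1)).1.trans ?_
      have := rpow_le_rpow hx0.le hr.1 hδ.le
      gcongr M * Real.exp ?_
      nlinarith
  have hPM : ∀ s ∈ Ioo 0 T, ∀ r ∈ Icc x (x + 3), |P s r| ≤ M := fun s hs r hr => by
    refine (hPx s hs r hr).trans (mul_le_of_le_one_right hM.le (exp_le_one_iff.2 ?_))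
    have := rpow_nonneg hx0.le δ
    nlinarith
  have hpM : ∀ s ∈ Ioo 0 T, ∀ r ∈ Icc x (x + 3), |pR P s r| ≤ M := fun s hs r hr =>
    (hg s hs r (hx0.trans_le hr.1)).2
  have hX0 : 0 < X := by linarith
  have hY0 : 0 < Y := by linarith
  have hXY : 1 ≤ X ^ 2 * Y := one_le_mul_of_one_le_of_one_le (one_le_pow₀ hX1) hY1
  have hB1 : κ * 4 ^ (2 * γ) * X ≤ B * X := by
    rw [hB, add_mul]
    exact le_add_of_nonneg_right (by positivity)
  have hB2 : ((|α| + 4 * |β|) * M + 4 * M) * X ≤ B * X := by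
    rw [hB, add_mul (κ * _)]
    exact le_add_of_nonneg_left (by positivity)
  have key := hP.integral_bump_mul_pR_sq_le (M := M) (e := c / (X ^ 2 * Y ^ 2)) (Λ := B * X)
    (κ := κ) (x := x) (t := t) (h := t₁ / 2 / (X ^ 2 * Y)) hx0 hκ0 hM ?_ ?_ hpM ?_ htT
    (by positivity) ?_
  · refine (mul_le_mul_of_nonneg_left key hY0.le).trans ?_
    have hid : Y * (3 * (18 * (c / (X ^ 2 * Y ^ 2)) * M + 9 * (c / (X ^ 2 * Y ^ 2)) * (B * X) / κ) +
        3 * (36 * (B * X) * M ^ 2 + 9 * (B * X) ^ 2 / κ + 36 * (B * X) * M) *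
          (t₁ / 2 / (X ^ 2 * Y)) + 27 * (c / (X ^ 2 * Y ^ 2)) ^ 2 / κ / (t₁ / 2 / (X ^ 2 * Y))) =
        3 * (18 * c * M / (X ^ 2 * Y) + 9 * c * B / κ / (X * Y)) +
        3 * (36 * B * M ^ 2 / X + 9 * B ^ 2 / κ + 36 * B * M / X) * (t₁ / 2)
          + 27 * c ^ 2 / κ / (t₁ / 2) / (X ^ 2 * Y ^ 2) := by
      field_simp
    rw [hid]
    have hXY' : 1 ≤ X * Y := one_le_mul_of_one_le_of_one_le hX1 hY1
    have hXY₂ : 1 ≤ X ^ 2 * Y ^ 2 :=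
      one_le_mul_of_one_le_of_one_le (one_le_pow₀ hX1) (one_le_pow₀ hY1)
    gcongr 3 * (?_ + ?_) + 3 * (?_ + _ + ?_) * (t₁ / 2) + ?_
    · exact div_le_self (by positivity) hXY
    · exact div_le_self (by positivity) hXY'
    · exact div_le_self (by positivity) hX1
    · exact div_le_self (by positivity) hX1
    · exact div_le_self (by positivity) hXY₂
  · intro r hr
    obtain ⟨h1, h4⟩ := hr1 r hr
    refine ⟨le_mul_of_one_le_right hκ0.le (one_le_rpow h1 (by linarith)), le_trans ?_ hB1⟩
    have : r ^ (2 * γ) ≤ 4 ^ (2 * γ) * x ^ (2 * γ) := by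
      rw [← mul_rpow (by norm_num) hx0.le]
      exact rpow_le_rpow (by linarith) h4 (by linarith)
    change κ * r ^ (2 * γ) ≤ _
    rw [mul_assoc κ]
    exact mul_le_mul_of_nonneg_left
      (this.trans (mul_le_mul_of_nonneg_left hxγ (by positivity))) hκ0.le
  · intro s hs r hr
    obtain ⟨h1, h4⟩ := hr1 r hr
    have hr0 : 0 < r := by linarith
    refine (abs_sub _ _).trans (le_trans ?_ hB2)
    rw [abs_mul, abs_mul, abs_of_pos hr0]
    have e1 : |α + β * r| ≤ (|α| + 4 * |β|) * X := by
      refine (abs_add_le _ _).trans ?_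
      rw [abs_mul, abs_of_pos hr0]
      have := abs_nonneg α
      have h5 := abs_nonneg β
      have : |β| * r ≤ |β| * (4 * X) := by gcongr; linarith
      nlinarith
    calc |α + β * r| * |pR P s r| + r * |P s r| ≤ (|α| + 4 * |β|) * X * M + (4 * X) * M := by
          gcongr
          exacts [hpM s hs r hr, by linarith, hPM s hs r hr]
      _ = _ := by ring
  · intro s hs r hr
    refine (hPx s hs r hr).trans ?_
    rw [hc, mul_div_assoc, ← hj]
    gcongr
    exact hexp x hx
  · exact (div_le_self (by positivity) hXY).trans_lt (by linarith [ht.1])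

/-- The weighted `L²` norm of `∂_r P` on unit intervals decays quadratically, locally uniformly
in time. -/
theorem exists_integral_rpow_mul_pR_sq_le (hP : IsCompleteSolution σ α β γ T P) (hσ : 0 < σ)
    (hγ : 0 ≤ γ) {a : ℝ} (ha : 0 ≤ a) {t₁ : ℝ} (ht₁ : 0 < t₁) :
    ∃ C, ∀ t ∈ Ioo t₁ T, ∀ x : ℝ, 1 ≤ x →
      ∫ r in (x + 1)..(x + 2), r ^ a * pR P t r ^ 2 ≤ C / x ^ 2 := by
  obtain ⟨C, hC⟩ := hP.exists_integral_bump_mul_pR_sq_le hσ hγ ha ht₁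
  refine ⟨3 ^ a * C, fun t ht x hx => ?_⟩
  have hx0 : 0 < x := by linarith
  have htT : t ∈ Ioo 0 T := ⟨ht₁.trans ht.1, ht.2⟩
  have hcont : ContinuousOn (fun r => ((r - x) * (x + 3 - r)) ^ 2 * pR P t r ^ 2) (Ici 0) := by
    have := hP.continuousOn_pR htT
    fun_prop
  have hcont' : ContinuousOn (fun r => r ^ a * pR P t r ^ 2) (Ici 0) :=
    (continuousOn_id.rpow_const fun _ _ => .inr ha).mul ((hP.continuousOn_pR htT).pow 2)
  have hint : ∀ {f : ℝ → ℝ} {u v : ℝ}, ContinuousOn f (Ici 0) → 0 ≤ u → u ≤ v →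
      IntervalIntegrable f volume u v := fun hf hu huv =>
    ContinuousOn.intervalIntegrable (hf.mono (by
      rw [uIcc_of_le huv]; exact fun r hr => hu.trans hr.1))
  calc ∫ r in (x + 1)..(x + 2), r ^ a * pR P t r ^ 2
      ≤ ∫ r in (x + 1)..(x + 2),
          (3 * x) ^ a * (((r - x) * (x + 3 - r)) ^ 2 * pR P t r ^ 2) := by
        refine intervalIntegral.integral_mono_on (by linarith)
          (hint hcont' (by linarith) (by linarith))
          ((hint hcont (by linarith) (by linarith)).const_mul _) fun r hr => ?_
        have hr0 : 0 ≤ r := by linarith [hr.1]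
        have h1 : 1 ≤ ((r - x) * (x + 3 - r)) ^ 2 :=
          one_le_pow₀ (by nlinarith [hr.1, hr.2])
        have h2 : r ^ a ≤ (3 * x) ^ a := rpow_le_rpow hr0 (by linarith [hr.2]) ha
        gcongr
        exact le_mul_of_one_le_left (sq_nonneg _) h1
    _ = (3 * x) ^ a * ∫ r in (x + 1)..(x + 2), ((r - x) * (x + 3 - r)) ^ 2 * pR P t r ^ 2 :=
        intervalIntegral.integral_const_mul _ _
    _ ≤ (3 * x) ^ a * ∫ r in x..(x + 3), ((r - x) * (x + 3 - r)) ^ 2 * pR P t r ^ 2 := by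
        gcongr
        exact intervalIntegral.integral_mono_interval (by linarith) (by linarith) (by linarith)
          (.of_forall fun r => by positivity) (hint hcont (by linarith) (by linarith))
    _ = 3 ^ a * (x ^ (a + 2) * ∫ r in x..(x + 3), ((r - x) * (x + 3 - r)) ^ 2 * pR P t r ^ 2)
          / x ^ 2 := by
        rw [mul_rpow (by norm_num) hx0.le, rpow_add hx0, rpow_two]
        field_simp
    _ ≤ 3 ^ a * C / x ^ 2 := by
        gcongr
        exact hC t ht x hx

end IsCompleteSolution

/-- A sequence of functions converges uniformly if its distance to the limit is bounded by a null
sequence. -/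
theorem tendstoUniformlyOn_of_abs_sub_le {f : ℕ → ℝ → ℝ} {g : ℝ → ℝ} {S : Set ℝ} {b : ℕ → ℝ}
    (hb : Tendsto b atTop (𝓝 0)) (h : ∀ n, ∀ t ∈ S, |g t - f n t| ≤ b n) :
    TendstoUniformlyOn f g atTop S := by
  rw [Metric.tendstoUniformlyOn_iff]
  intro ε hε
  filter_upwards [hb.eventually_lt_const hε] with n hn t ht
  exact (h n t ht).trans_lt hn

theorem tendsto_inv_natCast_add_two :
    Tendsto (fun n : ℕ => ((n : ℝ) + 2)⁻¹) atTop (𝓝 0) :=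
  tendsto_inv_atTop_zero.comp (tendsto_atTop_add_const_right _ _ tendsto_natCast_atTop_atTop)

theorem inv_natCast_add_two_le (n : ℕ) : ((n : ℝ) + 2)⁻¹ ≤ (n : ℝ) + 2 :=
  (inv_le_one_of_one_le₀ (by linarith [n.cast_nonneg (α := ℝ)])).trans
    (by linarith [n.cast_nonneg (α := ℝ)])

/-- Exhaustion of `(0, ∞)` by compact intervals. -/
theorem tendsto_intervalIntegral_Ioi_zero {g : ℝ → ℝ} (hg : IntegrableOn g (Ioi 0)) :
    Tendsto (fun n : ℕ => ∫ r in ((n : ℝ) + 2)⁻¹..((n : ℝ) + 2), g r) atTop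
      (𝓝 (∫ r in Ioi 0, g r)) := by
  have hcov : AECover (volume.restrict (Ioi (0 : ℝ))) atTop
      fun n : ℕ => Ioi ((n : ℝ) + 2)⁻¹ ∩ Iic ((n : ℝ) + 2) :=
    (aecover_Ioi_of_Ioi tendsto_inv_natCast_add_two).inter
      (aecover_Iic (tendsto_atTop_add_const_right _ _ tendsto_natCast_atTop_atTop))
  refine (hcov.integral_tendsto_of_countably_generated hg).congr fun n => ?_
  have hsub : Ioc ((n : ℝ) + 2)⁻¹ ((n : ℝ) + 2) ⊆ Ioi 0 := fun r hr =>
    (by positivity : (0 : ℝ) < ((n : ℝ) + 2)⁻¹).trans hr.1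
  rw [intervalIntegral.integral_of_le (inv_natCast_add_two_le n), Ioi_inter_Iic,
    Measure.restrict_restrict measurableSet_Ioc, inter_eq_left.2 hsub]

/-- Uniform convergence of truncated integrals of a dominated family. -/
theorem tendstoUniformlyOn_intervalIntegral {w : ℝ → ℝ → ℝ} {g : ℝ → ℝ} {S : Set ℝ}
    (hw : ∀ t ∈ S, IntegrableOn (w t) (Ioi 0)) (hg : IntegrableOn g (Ioi 0))
    (h : ∀ t ∈ S, ∀ r > 0, |w t r| ≤ g r) :
    TendstoUniformlyOn (fun (n : ℕ) t => ∫ r in ((n : ℝ) + 2)⁻¹..((n : ℝ) + 2), w t r)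
      (fun t => ∫ r in Ioi 0, w t r) atTop S := by
  refine tendstoUniformlyOn_of_abs_sub_le
    (b := fun n => (∫ r in Ioi 0, g r) - ∫ r in ((n : ℝ) + 2)⁻¹..((n : ℝ) + 2), g r) ?_ ?_
  · simpa using (tendsto_intervalIntegral_Ioi_zero hg).const_sub (∫ r in Ioi 0, g r)
  · intro n t ht
    have hsub : Ioc ((n : ℝ) + 2)⁻¹ ((n : ℝ) + 2) ⊆ Ioi 0 := fun r hr =>
      (by positivity : (0 : ℝ) < ((n : ℝ) + 2)⁻¹).trans hr.1
    rw [intervalIntegral.integral_of_le (inv_natCast_add_two_le n),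
      intervalIntegral.integral_of_le (inv_natCast_add_two_le n),
      ← setIntegral_sdiff measurableSet_Ioc (hw t ht) hsub,
      ← setIntegral_sdiff measurableSet_Ioc hg hsub]
    have hgi : IntegrableOn g (Ioi 0 \ Ioc ((n : ℝ) + 2)⁻¹ ((n : ℝ) + 2)) :=
      hg.mono_set sdiff_subset
    rw [← norm_eq_abs]
    refine norm_integral_le_of_norm_le hgi ?_
    filter_upwards [ae_restrict_mem (measurableSet_Ioi.diff measurableSet_Ioc)] with r hr
    exact h t ht r hr.1

theorem integrableOn_rpow_mul_exp_neg_mul_rpow_Ioi {m δ s : ℝ} (hm : 0 < m) (hδ : 0 < δ)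
    (hs : -1 < s) : IntegrableOn (fun r : ℝ => r ^ s * Real.exp (-m * r ^ δ)) (Ioi 0) := by
  refine Integrable.of_integral_ne_zero ?_
  rw [_root_.integral_rpow_mul_exp_neg_mul_rpow hδ hs hm]
  have := Real.Gamma_pos_of_pos (div_pos (by linarith : 0 < s + 1) hδ)
  positivity

theorem tendsto_rpow_mul_exp_neg_mul_rpow_atTop {m δ : ℝ} (hm : 0 < m) (hδ : 0 < δ) (s : ℝ) :
    Tendsto (fun r : ℝ => r ^ s * Real.exp (-m * r ^ δ)) atTop (𝓝 0) := by
  obtain ⟨C, hC, h⟩ := exists_exp_neg_mul_rpow_le hm hδ (s + 1)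
  refine squeeze_zero' (g := fun r => C / r) ?_ ?_ (tendsto_const_nhds.div_atTop tendsto_id)
  · filter_upwards [eventually_ge_atTop 0] with r hr
    positivity
  · filter_upwards [eventually_ge_atTop 1] with r hr
    have hr0 : 0 < r := by linarith
    refine (mul_le_mul_of_nonneg_left (h r hr) (by positivity)).trans_eq ?_
    rw [rpow_add_one hr0.ne']
    field_simp

theorem tendsto_rpow_mul_exp_neg_mul_rpow_nhdsGT {m δ s : ℝ} (hm : 0 < m) (hs : 0 < s) :
    Tendsto (fun r : ℝ => r ^ s * Real.exp (-m * r ^ δ)) (𝓝[>] 0) (𝓝 0) := by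
  have h0 : Tendsto (fun r : ℝ => r ^ s) (𝓝[>] 0) (𝓝 0) := by
    simpa [zero_rpow hs.ne'] using
      ((continuousAt_rpow_const 0 s (.inr hs.le)).tendsto).mono_left nhdsWithin_le_nhds
  refine squeeze_zero' ?_ ?_ h0
  · filter_upwards [self_mem_nhdsWithin] with r hr
    have hr' : 0 < r := hr
    positivity
  · filter_upwards [self_mem_nhdsWithin] with r hr
    have hr' : 0 < r := hr
    refine mul_le_of_le_one_right (by positivity) (exp_le_one_iff.2 ?_)
    have := rpow_nonneg hr'.le δ
    nlinarith

/-- Boundary terms with exponential decay vanish uniformly along the exhaustion. -/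
theorem tendstoUniformlyOn_boundary {u : ℝ → ℝ → ℝ} {S : Set ℝ} {B m δ s : ℝ} (hm : 0 < m)
    (hδ : 0 < δ) (hs : 0 < s) (h : ∀ t ∈ S, ∀ r > 0, |u t r| ≤ B * Real.exp (-m * r ^ δ)) :
    TendstoUniformlyOn (fun (n : ℕ) t => ((n : ℝ) + 2) ^ s * u t ((n : ℝ) + 2)
      - ((n : ℝ) + 2)⁻¹ ^ s * u t ((n : ℝ) + 2)⁻¹) (fun _ => 0) atTop S := by
  have hN : Tendsto (fun n : ℕ => (n : ℝ) + 2) atTop atTop :=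
    tendsto_atTop_add_const_right _ _ tendsto_natCast_atTop_atTop
  have hε : Tendsto (fun n : ℕ => ((n : ℝ) + 2)⁻¹) atTop (𝓝[>] 0) :=
    tendsto_inv_atTop_nhdsGT_zero.comp hN
  have lim := (((tendsto_rpow_mul_exp_neg_mul_rpow_atTop hm hδ s).comp hN).const_mul B).add
    (((tendsto_rpow_mul_exp_neg_mul_rpow_nhdsGT (δ := δ) hm hs).comp hε).const_mul B)
  simp only [mul_zero, add_zero, Function.comp_def] at lim
  have key : ∀ t ∈ S, ∀ r > 0, |r ^ s * u t r| ≤ B * (r ^ s * Real.exp (-m * r ^ δ)) :=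
    fun t ht r hr => by
      rw [abs_mul, abs_of_pos (rpow_pos_of_pos hr s), mul_left_comm]
      gcongr
      exact h t ht r hr
  refine tendstoUniformlyOn_of_abs_sub_le lim fun n t ht => ?_
  rw [zero_sub, abs_neg]
  exact (abs_sub _ _).trans (add_le_add (key t ht _ (by positivity)) (key t ht _ (by positivity)))

namespace IsCompleteSolution

variable {σ α β γ T : ℝ} {P : ℝ → ℝ → ℝ}

theorem exists_sq_le (hP : IsCompleteSolution σ α β γ T P) :
    ∃ B m δ : ℝ, 0 < m ∧ 0 < δ ∧ ∀ t ∈ Ioo 0 T, ∀ r > 0,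
      |P t r ^ 2| ≤ B * Real.exp (-m * r ^ δ) ∧ |P t r * pR P t r| ≤ B * Real.exp (-m * r ^ δ) ∧
      |pR P t r ^ 2| ≤ B := by
  obtain ⟨M, m, δ, hM, hm, hδ, hg⟩ := hP.growth
  refine ⟨M * M, m, δ, hm, hδ, fun t ht r hr => ?_⟩
  obtain ⟨h1, h2⟩ := hg t ht r hr
  have h3 : |P t r| ≤ M := by
    refine h1.trans (mul_le_of_le_one_right hM.le (exp_le_one_iff.2 ?_))
    have := rpow_nonneg hr.le δ
    nlinarith
  rw [sq, sq, abs_mul, abs_mul, abs_mul, mul_right_comm]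
  refine ⟨?_, ?_, ?_⟩ <;> gcongr

/-- Weighted `L²` norms of `P` are finite and are uniform limits of truncated integrals. -/
theorem integrableOn_and_tendstoUniformlyOn_sq (hP : IsCompleteSolution σ α β γ T P) {s : ℝ}
    (hs : -1 < s) :
    (∀ t ∈ Ioo 0 T, IntegrableOn (fun r => r ^ s * P t r ^ 2) (Ioi 0)) ∧
    TendstoUniformlyOn
      (fun (n : ℕ) t => ∫ r in ((n : ℝ) + 2)⁻¹..((n : ℝ) + 2), r ^ s * P t r ^ 2)
      (fun t => ∫ r in Ioi 0, r ^ s * P t r ^ 2) atTop (Ioo 0 T) := by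
  obtain ⟨B, m, δ, hm, hδ, hB⟩ := hP.exists_sq_le
  have hg := (integrableOn_rpow_mul_exp_neg_mul_rpow_Ioi hm hδ hs).const_mul B
  have hle : ∀ t ∈ Ioo 0 T, ∀ r > 0,
      |r ^ s * P t r ^ 2| ≤ B * (r ^ s * Real.exp (-m * r ^ δ)) := fun t ht r hr => by
    rw [abs_mul, abs_of_pos (rpow_pos_of_pos hr s), mul_left_comm]
    gcongr
    exact (hB t ht r hr).1
  have hint : ∀ t ∈ Ioo 0 T, IntegrableOn (fun r => r ^ s * P t r ^ 2) (Ioi 0) := fun t ht => by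
    refine Integrable.mono' hg (ContinuousOn.aestronglyMeasurable ?_ measurableSet_Ioi) ?_
    · exact (continuousOn_id.rpow_const fun r hr => .inl (ne_of_gt hr)).mul
        (((hP.continuousOn ht).mono Ioi_subset_Ici_self).pow 2)
    · filter_upwards [ae_restrict_mem measurableSet_Ioi] with r hr
      exact hle t ht r hr
  exact ⟨hint, tendstoUniformlyOn_intervalIntegral hint hg hle⟩

theorem exists_integral_Ioi_rpow_mul_pR_sq_le (hP : IsCompleteSolution σ α β γ T P) (hσ : 0 < σ)
    (hγ : 0 ≤ γ) {a : ℝ} (ha : 0 ≤ a) {t₁ : ℝ} (ht₁ : 0 < t₁) :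
    ∃ C, ∀ t ∈ Ioo t₁ T, IntegrableOn (fun r => r ^ a * pR P t r ^ 2) (Ioi 0) ∧
      ∀ n : ℕ, ∫ r in Ioi ((n : ℝ) + 2), r ^ a * pR P t r ^ 2 ≤ C / ((n : ℝ) + 1) := by
  obtain ⟨C, hC⟩ := hP.exists_integral_rpow_mul_pR_sq_le hσ hγ ha ht₁
  refine ⟨2 * C, fun t ht => ?_⟩
  have htT : t ∈ Ioo 0 T := ⟨ht₁.trans ht.1, ht.2⟩
  set f : ℝ → ℝ := fun r => r ^ a * pR P t r ^ 2 with hf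
  have hcont : ContinuousOn f (Ici 0) :=
    (continuousOn_id.rpow_const fun _ _ => .inr ha).mul ((hP.continuousOn_pR htT).pow 2)
  have hint : ∀ {u v : ℝ}, 0 ≤ u → u ≤ v → IntervalIntegrable f volume u v := fun hu huv =>
    ContinuousOn.intervalIntegrable (hcont.mono (by
      rw [uIcc_of_le huv]; exact fun r hr => hu.trans hr.1))
  have hf0 : ∀ r, 0 ≤ r → 0 ≤ f r := fun r hr => by positivity
  have hC0 : 0 ≤ C := by
    have h1 := hC t ht 1 le_rfl
    have h2 : 0 ≤ ∫ r in (1 + 1 : ℝ)..(1 + 2), f r :=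
      intervalIntegral.integral_nonneg (by norm_num) fun r hr => hf0 r (by linarith [hr.1])
    simpa using h2.trans h1
  have hsum : ∀ n j : ℕ, ∫ r in ((n : ℝ) + 2)..((n : ℝ) + 2 + j), f r ≤
      2 * C * (1 / ((n : ℝ) + 1) - 1 / ((n : ℝ) + 1 + j)) := by
    intro n j
    induction j with
    | zero => simp
    | succ j ih =>
      have hn : (0 : ℝ) ≤ n := n.cast_nonneg
      have hj : (0 : ℝ) ≤ j := j.cast_nonneg
      push_cast
      rw [← intervalIntegral.integral_add_adjacent_intervals (b := (n : ℝ) + 2 + j)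
        (hint (by linarith) (by linarith)) (hint (by linarith) (by linarith))]
      have h1 := hC t ht ((n : ℝ) + 1 + j) (by linarith)
      rw [show (n : ℝ) + 1 + j + 1 = n + 2 + j by ring,
        show (n : ℝ) + 1 + j + 2 = n + 2 + (j + 1) by ring] at h1
      have h2 : C / ((n : ℝ) + 1 + j) ^ 2 ≤
          2 * C * (1 / ((n : ℝ) + 1 + j) - 1 / ((n : ℝ) + 1 + (j + 1))) := by
        rw [div_sub_div _ _ (by positivity) (by positivity), mul_div_assoc',
          div_le_div_iff₀ (by positivity) (by positivity)]
        have : 0 ≤ C * ((n : ℝ) + 1 + j) * ((n : ℝ) + j) := by positivity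
        nlinarith
      linarith
  have hsum' : ∀ n j : ℕ, ∫ r in ((n : ℝ) + 2)..((n : ℝ) + 2 + j), f r ≤ 2 * C / ((n : ℝ) + 1) :=
    fun n j => by
      refine (hsum n j).trans ?_
      rw [div_eq_mul_one_div (2 * C)]
      gcongr
      exact sub_le_self _ (by positivity)
  have hb : ∀ n : ℕ, Tendsto (fun j : ℕ => (n : ℝ) + 2 + j) atTop atTop := fun n =>
    tendsto_atTop_add_const_left _ _ tendsto_natCast_atTop_atTop
  have hIoi : ∀ n : ℕ, IntegrableOn f (Ioi ((n : ℝ) + 2)) := fun n => by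
    refine integrableOn_Ioi_of_intervalIntegral_norm_bounded (2 * C / ((n : ℝ) + 1)) _
      (fun j => ?_) (hb n) (.of_forall fun j => ?_)
    · exact (intervalIntegrable_iff_integrableOn_Ioc_of_le (by simp)).1
        (hint (by positivity) (by simp))
    · refine (intervalIntegral.integral_congr fun r hr => ?_).trans_le (hsum' n j)
      rw [uIcc_of_le (by simp)] at hr
      exact norm_of_nonneg (hf0 r (le_trans (by positivity) hr.1))
  refine ⟨?_, fun n => le_of_tendsto'
    (intervalIntegral_tendsto_integral_Ioi _ (hIoi n) (hb n)) (hsum' n)⟩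
  have h2 := hIoi 0
  rw [Nat.cast_zero, zero_add] at h2
  have h02 : (0 : ℝ) ≤ 2 := zero_le_two
  rw [← Ioc_union_Ioi_eq_Ioi h02]
  exact ((intervalIntegrable_iff_integrableOn_Ioc_of_le h02).1 (hint le_rfl h02)).union h2

/-- Weighted `L²` norms of `∂_r P` are finite and are uniform limits of truncated integrals, away
from the initial time. -/
theorem integrableOn_and_tendstoUniformlyOn_pR_sq (hP : IsCompleteSolution σ α β γ T P)
    (hσ : 0 < σ) (hγ : 0 ≤ γ) {a : ℝ} (ha : 0 ≤ a) {t₁ : ℝ} (ht₁ : 0 < t₁) :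
    (∀ t ∈ Ioo t₁ T, IntegrableOn (fun r => r ^ a * pR P t r ^ 2) (Ioi 0)) ∧
    TendstoUniformlyOn
      (fun (n : ℕ) t => ∫ r in ((n : ℝ) + 2)⁻¹..((n : ℝ) + 2), r ^ a * pR P t r ^ 2)
      (fun t => ∫ r in Ioi 0, r ^ a * pR P t r ^ 2) atTop (Ioo t₁ T) := by
  obtain ⟨C, hC⟩ := hP.exists_integral_Ioi_rpow_mul_pR_sq_le hσ hγ ha ht₁
  obtain ⟨B, m, δ, hm, hδ, hB⟩ := hP.exists_sq_le
  refine ⟨fun t ht => (hC t ht).1, ?_⟩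
  refine tendstoUniformlyOn_of_abs_sub_le
    (b := fun n : ℕ => B * ((n : ℝ) + 2)⁻¹ + C / ((n : ℝ) + 1)) ?_ fun n t ht => ?_
  · simpa using (tendsto_inv_natCast_add_two.const_mul B).add
      (tendsto_const_nhds.div_atTop (tendsto_atTop_add_const_right _ (1 : ℝ)
        tendsto_natCast_atTop_atTop))
  · have htT : t ∈ Ioo 0 T := ⟨ht₁.trans ht.1, ht.2⟩
    obtain ⟨hi, hn⟩ := hC t ht
    have hε : 0 < ((n : ℝ) + 2)⁻¹ := by positivity
    have hN : (0 : ℝ) < (n : ℝ) + 2 := by positivity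
    have hεN := inv_natCast_add_two_le n
    have h1 : 0 ≤ ∫ r in Ioi ((n : ℝ) + 2), r ^ a * pR P t r ^ 2 :=
      setIntegral_nonneg measurableSet_Ioi fun r hr => by
        have := hN.trans hr
        positivity
    have h2 : 0 ≤ ∫ r in Ioc 0 ((n : ℝ) + 2)⁻¹, r ^ a * pR P t r ^ 2 :=
      setIntegral_nonneg measurableSet_Ioc fun r hr => by
        have := hr.1
        positivity
    have h3 : ∫ r in Ioc 0 ((n : ℝ) + 2)⁻¹, r ^ a * pR P t r ^ 2 ≤ B * ((n : ℝ) + 2)⁻¹ := by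
      have := norm_setIntegral_le_of_norm_le_const (μ := volume)
        (s := Ioc 0 ((n : ℝ) + 2)⁻¹) (f := fun r => r ^ a * pR P t r ^ 2) (C := B) (by simp)
        fun r hr => ?_
      · refine (le_abs_self _).trans (this.trans_eq ?_)
        rw [Real.volume_real_Ioc_of_le hε.le, sub_zero]
      · have hr1 : r ≤ 1 := hr.2.trans (inv_le_one_of_one_le₀
          (by linarith [n.cast_nonneg (α := ℝ)]))
        rw [norm_mul]
        refine le_trans (mul_le_of_le_one_left (norm_nonneg _) ?_) (hB t htT r hr.1).2.2
        rw [norm_of_nonneg (rpow_nonneg hr.1.le a)]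
        exact rpow_le_one hr.1.le hr1 ha
    have hsplit : ∫ r in Ioi 0, r ^ a * pR P t r ^ 2 =
        (∫ r in Ioc 0 ((n : ℝ) + 2)⁻¹, r ^ a * pR P t r ^ 2) +
        ((∫ r in ((n : ℝ) + 2)⁻¹..((n : ℝ) + 2), r ^ a * pR P t r ^ 2) +
          ∫ r in Ioi ((n : ℝ) + 2), r ^ a * pR P t r ^ 2) := by
      rw [intervalIntegral.integral_of_le hεN, ← setIntegral_union Ioc_disjoint_Ioi_same
        measurableSet_Ioi (hi.mono_set fun r hr => hε.trans hr.1)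
        (hi.mono_set fun r hr => hN.trans hr), Ioc_union_Ioi_eq_Ioi hεN,
        ← setIntegral_union Ioc_disjoint_Ioi_same measurableSet_Ioi
        (hi.mono_set fun r hr => hr.1) (hi.mono_set fun r hr => hε.trans hr),
        Ioc_union_Ioi_eq_Ioi hε.le]
    rw [hsplit, abs_le]
    have := hn n
    constructor <;> linarith

/-- The energy identity on a compact interval, with boundary terms. -/
theorem integral_rpow_mul_pTau (hP : IsCompleteSolution σ α β γ T P) {t : ℝ} (ht : t ∈ Ioo 0 T)
    {x y : ℝ} (hx : 0 < x) (hxy : x ≤ y) (ω : ℝ) :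
    ∫ r in x..y, r ^ ω * (2 * P t r * pTau P t r) =
      2 * ((σ^2/2) * (y ^ (2*γ + ω) * (P t y * pR P t y) - x ^ (2*γ + ω) * (P t x * pR P t x))
        - (σ^2/4) * (2*γ + ω) *
          (y ^ (2*γ + ω - 1) * P t y ^ 2 - x ^ (2*γ + ω - 1) * P t x ^ 2)
        + (α/2) * (y ^ ω * P t y ^ 2 - x ^ ω * P t x ^ 2)
        + (β/2) * (y ^ (ω + 1) * P t y ^ 2 - x ^ (ω + 1) * P t x ^ 2)
        + ((σ^2/4) * (2*γ + ω) * (2*γ + ω - 1) * (∫ r in x..y, r ^ (2*γ + ω - 2) * P t r ^ 2)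
          - (σ^2/2) * (∫ r in x..y, r ^ (2*γ + ω) * pR P t r ^ 2)
          - (α*ω/2) * (∫ r in x..y, r ^ (ω - 1) * P t r ^ 2)
          - ((ω + 1)*β/2) * (∫ r in x..y, r ^ ω * P t r ^ 2)
          - ∫ r in x..y, r ^ (ω + 1) * P t r ^ 2)) := by
  have hu : uIcc x y = Icc x y := uIcc_of_le hxy
  have hI : uIcc x y ⊆ Ici 0 := fun r hr => hx.le.trans (hu ▸ hr).1
  have hpow : ∀ s : ℝ, ContinuousOn (fun r : ℝ => r ^ s) (uIcc x y) := fun s =>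
    continuousOn_id.rpow_const fun r hr => .inl (hx.trans_le (hu ▸ hr).1).ne'
  have hc0 := (hP.continuousOn ht).mono hI
  have hc1 := (hP.continuousOn_pR ht).mono hI
  have hct := (hP.continuousOn_pTau ht).mono hI
  have i0 : ∀ s : ℝ, IntervalIntegrable (fun r => r ^ s * P t r ^ 2) volume x y := fun s =>
    ((hpow s).mul (hc0.pow 2)).intervalIntegrable
  have i1 : IntervalIntegrable (fun r => r ^ (2*γ + ω) * pR P t r ^ 2) volume x y :=
    ((hpow _).mul (hc1.pow 2)).intervalIntegrable
  have it : IntervalIntegrable (fun r => r ^ ω * (2 * P t r * pTau P t r)) volume x y :=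
    ((hpow ω).mul ((continuousOn_const.mul hc0).mul hct)).intervalIntegrable
  have iG := (((((i0 (2*γ + ω - 2)).const_mul ((σ^2/4) * (2*γ + ω) * (2*γ + ω - 1))).sub
    (i1.const_mul (σ^2/2))).sub ((i0 (ω - 1)).const_mul (α*ω/2))).sub
    ((i0 ω).const_mul ((ω + 1)*β/2))).sub (i0 (ω + 1))
  have key := intervalIntegral.integral_eq_sub_of_hasDerivAt (a := x) (b := y)
    (f := fun r => (σ^2/2) * (r ^ (2*γ + ω) * (P t r * pR P t r))
      - (σ^2/4) * (2*γ + ω) * (r ^ (2*γ + ω - 1) * P t r ^ 2)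
      + (α/2) * (r ^ ω * P t r ^ 2) + (β/2) * (r ^ (ω + 1) * P t r ^ 2))
    (f' := fun r => (1/2) * (r ^ ω * (2 * P t r * pTau P t r)) -
      ((σ^2/4) * (2*γ + ω) * (2*γ + ω - 1) * (r ^ (2*γ + ω - 2) * P t r ^ 2)
        - (σ^2/2) * (r ^ (2*γ + ω) * pR P t r ^ 2) - (α*ω/2) * (r ^ (ω - 1) * P t r ^ 2)
        - ((ω + 1)*β/2) * (r ^ ω * P t r ^ 2) - r ^ (ω + 1) * P t r ^ 2)) ?_
    ((it.const_mul (1/2)).sub iG)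
  · rw [intervalIntegral.integral_sub (it.const_mul (1/2)) iG,
      intervalIntegral.integral_sub
        (((((i0 _).const_mul _).sub (i1.const_mul _)).sub ((i0 _).const_mul _)).sub
          ((i0 _).const_mul _)) (i0 _),
      intervalIntegral.integral_sub
        ((((i0 _).const_mul _).sub (i1.const_mul _)).sub ((i0 _).const_mul _))
          ((i0 _).const_mul _),
      intervalIntegral.integral_sub (((i0 _).const_mul _).sub (i1.const_mul _))
        ((i0 _).const_mul _),
      intervalIntegral.integral_sub ((i0 _).const_mul _) (i1.const_mul _)] at key
    simp only [intervalIntegral.integral_const_mul] at key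
    linear_combination 2 * key
  · intro r hr
    have hr0 : 0 < r := hx.trans_le (hu ▸ hr).1
    have hd := hP.hasDerivAt_r ht hr0.le
    have hdr := hP.hasDerivAt_rr ht hr0.le
    have hp : ∀ s : ℝ, HasDerivAt (fun r : ℝ => r ^ s) (s * r ^ (s - 1)) r := fun s =>
      hasDerivAt_rpow_const (.inl hr0.ne')
    refine ((((((hp (2*γ + ω)).mul (hd.mul hdr)).const_mul (σ^2/2)).sub
      (((hp (2*γ + ω - 1)).mul (hd.pow 2)).const_mul ((σ^2/4) * (2*γ + ω)))).add
      (((hp ω).mul (hd.pow 2)).const_mul (α/2))).add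
      (((hp (ω + 1)).mul (hd.pow 2)).const_mul (β/2))).congr_deriv ?_
    have e1 : r ^ (2*γ + ω) = r ^ (2*γ) * r ^ ω := rpow_add hr0 _ _
    have e2 : r ^ (ω + 1) = r ^ ω * r := rpow_add_one hr0.ne' _
    have hpde := hP.pde t ht r hr0
    rw [show 2*γ + ω - 1 - 1 = 2*γ + ω - 2 by ring, add_sub_cancel_right]
    simp only [Pi.mul_apply, Pi.pow_apply, e1, e2]
    norm_num
    linear_combination (r ^ ω * P t r) * hpde

end IsCompleteSolution

/-- the energy identity
`(1/2) d/dτ ∫₀^∞ r^ω P² = (σ²/4)(2γ+ω)(2γ+ω-1)∫₀^∞ r^{2γ+ω-2} P²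
 - (σ²/2)∫₀^∞ r^{2γ+ω}(∂_r P)² - (αω/2)∫₀^∞ r^{ω-1} P²
 - ((ω+1)β/2)∫₀^∞ r^ω P² - ∫₀^∞ r^{ω+1} P²`,
all the integrals involved being finite. -/
theorem energy_identity (σ α β γ T : ℝ) (hσ : 0 < σ) (hα : 0 < α) (hγ : 0 ≤ γ)
    (hT : 0 < T) (P : ℝ → ℝ → ℝ) (hP : IsCompleteSolution σ α β γ T P)
    (ω : ℝ) (hω : 0 < ω) (hω2 : 2*γ + ω - 1 > 0) :
    ∀ τ ∈ Ioo (0:ℝ) T,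
      IntegrableOn (fun r => r ^ ω * (P τ r)^2) (Ioi 0) ∧
      IntegrableOn (fun r => r ^ (2*γ + ω - 2) * (P τ r)^2) (Ioi 0) ∧
      IntegrableOn (fun r => r ^ (2*γ + ω) * (pR P τ r)^2) (Ioi 0) ∧
      IntegrableOn (fun r => r ^ (ω - 1) * (P τ r)^2) (Ioi 0) ∧
      IntegrableOn (fun r => r ^ (ω + 1) * (P τ r)^2) (Ioi 0) ∧
      ∃ D : ℝ, HasDerivAt (fun t => ∫ r in Ioi (0:ℝ), r ^ ω * (P t r)^2) D τ ∧
        (1/2) * D =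
          (σ^2/4) * (2*γ + ω) * (2*γ + ω - 1) *
              (∫ r in Ioi (0:ℝ), r ^ (2*γ + ω - 2) * (P τ r)^2)
            - (σ^2/2) * (∫ r in Ioi (0:ℝ), r ^ (2*γ + ω) * (pR P τ r)^2)
            - (α*ω/2) * (∫ r in Ioi (0:ℝ), r ^ (ω - 1) * (P τ r)^2)
            - ((ω + 1)*β/2) * (∫ r in Ioi (0:ℝ), r ^ ω * (P τ r)^2)
            - ∫ r in Ioi (0:ℝ), r ^ (ω + 1) * (P τ r)^2 := by
  intro τ hτ
  have ht₁ : 0 < τ / 2 := half_pos hτ.1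
  have hτS : τ ∈ Ioo (τ / 2) T := ⟨half_lt_self hτ.1, hτ.2⟩
  have hS : Ioo (τ / 2) T ⊆ Ioo 0 T := Ioo_subset_Ioo_left ht₁.le
  obtain ⟨j1, u1⟩ := hP.integrableOn_and_tendstoUniformlyOn_sq (s := ω) (by linarith)
  obtain ⟨j2, u2⟩ := hP.integrableOn_and_tendstoUniformlyOn_sq (s := 2*γ + ω - 2) (by linarith)
  obtain ⟨j3, u3⟩ := hP.integrableOn_and_tendstoUniformlyOn_pR_sq hσ hγ
    (a := 2*γ + ω) (by linarith) ht₁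
  obtain ⟨j4, u4⟩ := hP.integrableOn_and_tendstoUniformlyOn_sq (s := ω - 1) (by linarith)
  obtain ⟨j5, u5⟩ := hP.integrableOn_and_tendstoUniformlyOn_sq (s := ω + 1) (by linarith)
  obtain ⟨B, m, δ, hm, hδ, hB⟩ := hP.exists_sq_le
  have b1 := tendstoUniformlyOn_boundary (u := fun t r => P t r * pR P t r) (S := Ioo (τ / 2) T)
    hm hδ (s := 2*γ + ω) (by linarith) fun t ht r hr => (hB t (hS ht) r hr).2.1
  have b2 : ∀ s > (0 : ℝ), _ := fun s hs =>
    tendstoUniformlyOn_boundary (u := fun t r => P t r ^ 2) (S := Ioo (τ / 2) T)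
    hm hδ (s := s) hs fun t ht r hr => (hB t (hS ht) r hr).1
  have hmul : ∀ {f : ℕ → ℝ → ℝ} {g : ℝ → ℝ} (c : ℝ),
      TendstoUniformlyOn f g atTop (Ioo (τ / 2) T) →
      TendstoUniformlyOn (fun n t => c * f n t) (fun t => c * g t) atTop (Ioo (τ / 2) T) :=
    fun c h => (uniformContinuous_const_smul c).comp_tendstoUniformlyOn h
  have hlim := hmul 2 (((((hmul (σ^2/2) b1).sub
      (hmul ((σ^2/4) * (2*γ + ω)) (b2 (2*γ + ω - 1) hω2))).add
      (hmul (α/2) (b2 ω hω))).add (hmul (β/2) (b2 (ω + 1) (by linarith)))).add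
    (((((hmul ((σ^2/4) * (2*γ + ω) * (2*γ + ω - 1)) (u2.mono hS)).sub
      (hmul (σ^2/2) u3)).sub (hmul (α*ω/2) (u4.mono hS))).sub
      (hmul ((ω + 1)*β/2) (u1.mono hS))).sub (u5.mono hS)))
  refine ⟨j1 τ hτ, j2 τ hτ, j3 τ hτS, j4 τ hτ, j5 τ hτ, _,
    hasDerivAt_of_tendstoUniformlyOn isOpen_Ioo hlim (.of_forall fun n t ht => ?_)
      (fun t ht => u1.tendsto_at (hS ht)) hτS, ?_⟩
  · have hε : 0 < ((n : ℝ) + 2)⁻¹ := by positivity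
    have hεN := inv_natCast_add_two_le n
    refine (hP.hasDerivAt_integral_mul_sq (hS ht) hε hεN
      (continuousOn_id.rpow_const fun r hr => .inl (hε.trans_le hr.1).ne')).congr_deriv ?_
    exact hP.integral_rpow_mul_pTau (hS ht) hε hεN ω
  · simp
end
end
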